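/- arXiv:math/0409246 — 10 statements merged into one kernel-verified Lean document; each statement's English description precedes it below -/
import Mathlib

section
/- Let T > 0, let ψ : ℝ × [0,T] → ℝ be continuous, and let R, r : [0,T] → ℝ be continuous with r(t) = R(0) + ∫₀^t ψ(r(s), s) ds for all t, and R(t) = R(0) + ∫₀^t F(s) ds for a regulated function F : [0,T] → ℝ (F possesses one-sided limits at every point) all of whose one-sided limits satisfy F(s−) < ψ(R(s), s) and F(s+) < ψ(R(s), s) for every s ∈ [0,T]. Then R(t) < r(t) for every t ∈ (0,T]. -/
open Set Filter MeasureTheory Topology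

/-- A function with one-sided limits at `s` is, near `s`, uniformly approximated by a measurable
function. -/
lemma exists_measurable_approx_nhds {F : ℝ → ℝ} {s l₁ l₂ ε : ℝ} (hε : 0 < ε)
    (h₁ : Tendsto F (𝓝[<] s) (𝓝 l₁)) (h₂ : Tendsto F (𝓝[>] s) (𝓝 l₂)) :
    ∃ g : ℝ → ℝ, Measurable g ∧ (∃ C, ∀ x, |g x| ≤ C) ∧ ∀ᶠ x in 𝓝 s, |F x - g x| ≤ ε := by
  refine ⟨fun x => if x < s then l₁ else if x = s then F s else l₂,
    Measurable.ite measurableSet_Iio measurable_const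
      (Measurable.ite (measurableSet_singleton s) measurable_const measurable_const),
    ⟨|l₁| + |F s| + |l₂|, fun x => ?_⟩, ?_⟩
  · have := abs_nonneg l₁
    have := abs_nonneg l₂
    have := abs_nonneg (F s)
    dsimp only
    split_ifs <;> linarith
  · have e₁ := eventually_nhdsWithin_iff.1 (h₁.eventually (Metric.ball_mem_nhds l₁ hε))
    have e₂ := eventually_nhdsWithin_iff.1 (h₂.eventually (Metric.ball_mem_nhds l₂ hε))
    filter_upwards [e₁, e₂] with x hx₁ hx₂
    rcases lt_trichotomy x s with h | rfl | h
    · rw [if_pos h]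
      exact (hx₁ h).le
    · simp [hε.le]
    · rw [if_neg h.not_gt, if_neg h.ne']
      exact (hx₂ h).le

/-- A function with one-sided limits at every point of a compact set is uniformly approximated
there by bounded measurable functions. -/
lemma IsCompact.exists_measurable_approx {F : ℝ → ℝ} {K : Set ℝ} (hK : IsCompact K)
    (hL : ∀ s ∈ K, ∃ l, Tendsto F (𝓝[<] s) (𝓝 l))
    (hR : ∀ s ∈ K, ∃ l, Tendsto F (𝓝[>] s) (𝓝 l)) {ε : ℝ} (hε : 0 < ε) :
    ∃ g : ℝ → ℝ, Measurable g ∧ (∃ C, ∀ x, |g x| ≤ C) ∧ ∀ x ∈ K, |F x - g x| ≤ ε := by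
  suffices ∃ M, MeasurableSet M ∧ K ⊆ M ∧ ∃ g : ℝ → ℝ, Measurable g ∧ (∃ C, ∀ x, |g x| ≤ C) ∧
      ∀ x ∈ M, |F x - g x| ≤ ε by
    obtain ⟨M, -, hKM, g, hg, hC, hgM⟩ := this
    exact ⟨g, hg, hC, fun x hx => hgM x (hKM hx)⟩
  refine hK.induction_on (p := fun S => ∃ M, MeasurableSet M ∧ S ⊆ M ∧ ∃ g : ℝ → ℝ,
    Measurable g ∧ (∃ C, ∀ x, |g x| ≤ C) ∧ ∀ x ∈ M, |F x - g x| ≤ ε) ?_ ?_ ?_ ?_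
  · exact ⟨∅, .empty, subset_rfl, 0, measurable_zero, ⟨0, by simp⟩, by simp⟩
  · rintro S S' hS ⟨M, hM, hSM, h⟩
    exact ⟨M, hM, hS.trans hSM, h⟩
  · rintro S S' ⟨M, hM, hSM, g, hg, ⟨C, hC⟩, hgM⟩ ⟨M', hM', hSM', g', hg', ⟨C', hC'⟩, hgM'⟩
    classical
    refine ⟨M ∪ M', hM.union hM', union_subset_union hSM hSM', M.piecewise g g',
      hg.piecewise hM hg', ⟨max C C', fun x => ?_⟩, fun x hx => ?_⟩
    · by_cases h : x ∈ M
      · simpa [h] using Or.inl (hC x)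
      · simpa [h] using Or.inr (hC' x)
    · by_cases h : x ∈ M
      · simpa [h] using hgM x h
      · simpa [h] using hgM' x (hx.resolve_left h)
  · intro s hs
    obtain ⟨l₁, h₁⟩ := hL s hs
    obtain ⟨l₂, h₂⟩ := hR s hs
    obtain ⟨g, hg, hC, hgF⟩ := exists_measurable_approx_nhds hε h₁ h₂
    obtain ⟨U, hU, hUo, hsU⟩ := eventually_nhds_iff.1 hgF
    exact ⟨U, mem_nhdsWithin_of_mem_nhds (hUo.mem_nhds hsU),
      U, hUo.measurableSet, subset_rfl, g, hg, hC, hU⟩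

/-- A function with one-sided limits at every point of a compact set is integrable on it. -/
lemma IsCompact.integrableOn_of_tendsto_left_right {F : ℝ → ℝ} {K : Set ℝ} (hK : IsCompact K)
    (hL : ∀ s ∈ K, ∃ l, Tendsto F (𝓝[<] s) (𝓝 l))
    (hR : ∀ s ∈ K, ∃ l, Tendsto F (𝓝[>] s) (𝓝 l)) : IntegrableOn F K := by
  have approx := fun n : ℕ =>
    hK.exists_measurable_approx hL hR (Nat.one_div_pos_of_nat (α := ℝ) (n := n))
  choose g hg hC hgF using approx
  have hmeas : AEStronglyMeasurable F (volume.restrict K) := by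
    refine aestronglyMeasurable_of_tendsto_ae atTop (fun n => (hg n).aestronglyMeasurable)
      ((ae_restrict_iff' hK.measurableSet).2 (ae_of_all _ fun x hx => ?_))
    rw [tendsto_iff_dist_tendsto_zero]
    refine squeeze_zero (fun _ => dist_nonneg) (fun n => ?_)
      (tendsto_one_div_add_atTop_nhds_zero_nat (𝕜 := ℝ))
    rw [dist_comm, Real.dist_eq]
    exact hgF n x hx
  obtain ⟨C, hC⟩ := hC 0
  refine IntegrableOn.of_bound hK.measure_lt_top hmeas (C + 1)
    ((ae_restrict_iff' hK.measurableSet).2 (ae_of_all _ fun x hx => ?_))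
  have h₀ := hgF 0 x hx
  have h₁ := hC x
  norm_num at h₀
  rw [Real.norm_eq_abs]
  rw [abs_le] at *
  constructor <;> linarith [h₀.1, h₀.2, h₁.1, h₁.2]

lemma eventually_integral_pos_left {h : ℝ → ℝ} {a b l : ℝ} (hab : a < b)
    (hi : IntegrableOn h (Icc a b)) (hl : 0 < l) (ht : Tendsto h (𝓝[<] b) (𝓝 l)) :
    ∀ᶠ s in 𝓝[<] b, 0 < ∫ x in s..b, h x := by
  obtain ⟨c, hc, hpos⟩ := (mem_nhdsLT_iff_exists_Ioo_subset).1 (ht.eventually (lt_mem_nhds hl))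
  filter_upwards [Ioo_mem_nhdsLT (max_lt hab hc)] with s hs
  have has : a < s := (le_max_left _ _).trans_lt hs.1
  refine intervalIntegral.intervalIntegral_pos_of_pos_on ?_
    (fun x hx => hpos ⟨((le_max_right _ _).trans_lt hs.1).trans hx.1, hx.2⟩) hs.2
  rw [intervalIntegrable_iff_integrableOn_Icc_of_le hs.2.le]
  exact hi.mono_set (Icc_subset_Icc_left has.le)

lemma eventually_integral_pos_right {h : ℝ → ℝ} {a b l : ℝ} (hab : a < b)
    (hi : IntegrableOn h (Icc a b)) (hl : 0 < l) (ht : Tendsto h (𝓝[>] a) (𝓝 l)) :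
    ∀ᶠ s in 𝓝[>] a, 0 < ∫ x in a..s, h x := by
  obtain ⟨c, hc, hpos⟩ := (mem_nhdsGT_iff_exists_Ioo_subset).1 (ht.eventually (lt_mem_nhds hl))
  filter_upwards [Ioo_mem_nhdsGT (lt_min hab hc)] with s hs
  have hsb : s < b := hs.2.trans_le (min_le_left _ _)
  refine intervalIntegral.intervalIntegral_pos_of_pos_on ?_
    (fun x hx => hpos ⟨hx.1, hx.2.trans (hs.2.trans_le (min_le_right _ _))⟩) hs.1
  rw [intervalIntegrable_iff_integrableOn_Icc_of_le hs.1.le]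
  exact hi.mono_set (Icc_subset_Icc_right hsb.le)

/-- Strict comparison principle: if `r` solves `r t = R 0 + ∫₀ᵗ ψ (r s) s ds` for a
continuous `ψ`, and the continuous function `R` satisfies `R t = R 0 + ∫₀ᵗ F` with a
regulated rate `F` (one-sided limits exist at every point of `[0,T]`) all of whose
one-sided limits lie strictly below `ψ (R s) s`, then `R t < r t` for all `t ∈ (0,T]`. -/
theorem strict_comparison_below_ode (T : ℝ) (hT : 0 < T) (ψ : ℝ → ℝ → ℝ)
    (hψ : ContinuousOn (fun p : ℝ × ℝ => ψ p.1 p.2) (Set.univ ×ˢ Set.Icc 0 T))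
    (R r F : ℝ → ℝ)
    (hRcont : ContinuousOn R (Set.Icc 0 T))
    (hrcont : ContinuousOn r (Set.Icc 0 T))
    (hr : ∀ t ∈ Set.Icc (0 : ℝ) T, r t = R 0 + ∫ s in (0 : ℝ)..t, ψ (r s) s)
    (hR : ∀ t ∈ Set.Icc (0 : ℝ) T, R t = R 0 + ∫ s in (0 : ℝ)..t, F s)
    (hFlimL : ∀ s ∈ Set.Icc (0 : ℝ) T, ∃ l, Filter.Tendsto F (nhdsWithin s (Set.Iio s)) (nhds l))
    (hFlimR : ∀ s ∈ Set.Icc (0 : ℝ) T, ∃ l, Filter.Tendsto F (nhdsWithin s (Set.Ioi s)) (nhds l))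
    (hFltL : ∀ s ∈ Set.Icc (0 : ℝ) T, ∀ l,
      Filter.Tendsto F (nhdsWithin s (Set.Iio s)) (nhds l) → l < ψ (R s) s)
    (hFltR : ∀ s ∈ Set.Icc (0 : ℝ) T, ∀ l,
      Filter.Tendsto F (nhdsWithin s (Set.Ioi s)) (nhds l) → l < ψ (R s) s) :
    ∀ t ∈ Set.Ioc (0 : ℝ) T, R t < r t := by
  have hψr : ContinuousOn (fun s => ψ (r s) s) (Set.Icc 0 T) :=
    hψ.comp (hrcont.prodMk continuousOn_id) fun s hs => ⟨mem_univ _, hs⟩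
  have hFint : IntegrableOn F (Set.Icc 0 T) :=
    isCompact_Icc.integrableOn_of_tendsto_left_right hFlimL hFlimR
  have hψint : IntegrableOn (fun s => ψ (r s) s) (Set.Icc 0 T) := hψr.integrableOn_Icc
  have hint : IntegrableOn (fun s => ψ (r s) s - F s) (Set.Icc 0 T) := hψint.sub hFint
  have hdiff : ∀ t ∈ Set.Icc 0 T, r t - R t = ∫ s in (0 : ℝ)..t, (ψ (r s) s - F s) := by
    intro t ht
    have hsub : Set.Icc 0 t ⊆ Set.Icc 0 T := Icc_subset_Icc_right ht.2
    rw [intervalIntegral.integral_sub, hr t ht, hR t ht]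
    · ring
    · exact (intervalIntegrable_iff_integrableOn_Icc_of_le ht.1).2 (hψint.mono_set hsub)
    · exact (intervalIntegrable_iff_integrableOn_Icc_of_le ht.1).2 (hFint.mono_set hsub)
  have hr0 : r 0 = R 0 := by simpa using hr 0 ⟨le_rfl, hT.le⟩
  have hstart : ∀ᶠ s in 𝓝[>] (0 : ℝ), R s < r s := by
    have h0 : (0 : ℝ) ∈ Set.Icc 0 T := ⟨le_rfl, hT.le⟩
    obtain ⟨l, hl⟩ := hFlimR 0 h0
    have hlt := hFltR 0 h0 l hl
    rw [← hr0] at hlt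
    have htend : Tendsto (fun s => ψ (r s) s) (𝓝[>] 0) (𝓝 (ψ (r 0) 0)) :=
      (hψr 0 h0).mono_left (nhdsWithin_le_of_mem (Icc_mem_nhdsGT hT))
    filter_upwards [eventually_integral_pos_right hT hint (sub_pos.2 hlt) (htend.sub hl),
      Icc_mem_nhdsGT hT] with s hs hsT
    rw [← hdiff s hsT] at hs
    exact sub_pos.1 hs
  intro t ht
  by_contra! hcon
  obtain ⟨δ, hδ, hδ0, hδt⟩ := (hstart.and (Ioo_mem_nhdsGT ht.1)).exists
  have hsub : Set.Icc δ t ⊆ Set.Icc 0 T := Icc_subset_Icc hδ0.le ht.2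
  have hcont : ContinuousOn (fun s => r s - R s) (Set.Icc δ t) := (hrcont.sub hRcont).mono hsub
  have hcompact : IsCompact (Set.Icc δ t ∩ (fun s => r s - R s) ⁻¹' Set.Iic 0) :=
    isCompact_Icc.of_isClosed_subset (hcont.preimage_isClosed_of_isClosed isClosed_Icc isClosed_Iic)
      inter_subset_left
  obtain ⟨τ, ⟨hτ, hτle⟩, hτmin⟩ :=
    hcompact.exists_isLeast ⟨t, ⟨hδt.le, le_rfl⟩, sub_nonpos.2 hcon⟩
  have hτle : r τ ≤ R τ := sub_nonpos.1 hτle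
  have hδτ : δ < τ := hτ.1.lt_of_ne fun h => by subst h; exact hτle.not_gt hδ
  have hbefore : ∀ᶠ s in 𝓝[<] τ, R s < r s := by
    filter_upwards [Ioo_mem_nhdsLT hδτ] with s hs
    by_contra! h
    exact (hτmin ⟨⟨hs.1.le, hs.2.le.trans hτ.2⟩, sub_nonpos.2 h⟩).not_gt hs.2
  have hτT := hsub hτ
  have hnhds : 𝓝[<] τ ≤ 𝓝[Set.Icc 0 T] τ := nhdsWithin_le_of_mem <|
    mem_of_superset (Icc_mem_nhdsLT (hδ0.trans hδτ)) (Icc_subset_Icc_right hτT.2)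
  have heq : r τ = R τ := hτle.antisymm <|
    le_of_tendsto_of_tendsto ((hRcont τ hτT).mono_left hnhds) ((hrcont τ hτT).mono_left hnhds)
      (hbefore.mono fun _ h => h.le)
  obtain ⟨l, hl⟩ := hFlimL τ hτT
  have hlt := hFltL τ hτT l hl
  rw [← heq] at hlt
  have hpos := eventually_integral_pos_left (hδ0.trans hδτ)
    (hint.mono_set (Icc_subset_Icc_right hτT.2)) (sub_pos.2 hlt)
    (((hψr τ hτT).mono_left hnhds).sub hl)
  obtain ⟨s, ⟨hs, hspos⟩, hsδ, hsτ⟩ := ((hbefore.and hpos).and (Ioo_mem_nhdsLT hδτ)).exists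
  have hs0 : 0 ≤ s := hδ0.le.trans hsδ.le
  have hsT : s ∈ Set.Icc 0 T := ⟨hs0, hsτ.le.trans hτT.2⟩
  have hadd := intervalIntegral.integral_add_adjacent_intervals
    ((intervalIntegrable_iff_integrableOn_Icc_of_le hs0).2
      (hint.mono_set (Icc_subset_Icc_right hsT.2)))
    ((intervalIntegrable_iff_integrableOn_Icc_of_le hsτ.le).2
      (hint.mono_set (Icc_subset_Icc hs0 hτT.2)))
  rw [← hdiff s hsT, ← hdiff τ hτT] at hadd
  linarith
end

section
/- Let g : [0,∞) → ℝ be continuous, let T̂ ≥ 0 and 0 < m₁ < m₂ be such that m₁ < g(s) < m₂ for all s ≥ T̂, and set C₁ := ∫₀^{T̂} |g(s)| e^{-∫_s^{T̂} g(u) du} ds. Then for every t ≥ T̂, ∫₀^t |g(s)| e^{-∫_s^t g(u) du} ds ≤ C₁ + m₂/m₁. -/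
/-- The kernel `s ↦ exp (-∫ₛᵗ g)` satisfies the backward linear equation `y' = g y`. -/
theorem hasDerivAt_exp_neg_integral {g : ℝ → ℝ} (hg : Continuous g) (t s : ℝ) :
    HasDerivAt (fun s => Real.exp (-∫ u in s..t, g u))
      (g s * Real.exp (-∫ u in s..t, g u)) s := by
  have h := (intervalIntegral.integral_hasDerivAt_left (hg.intervalIntegrable s t)
    (hg.stronglyMeasurableAtFilter _ _) hg.continuousAt).fun_neg.exp
  simpa [mul_comm] using h

theorem continuous_exp_neg_integral {g : ℝ → ℝ} (hg : Continuous g) (t : ℝ) :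
    Continuous (fun s => Real.exp (-∫ u in s..t, g u)) :=
  continuous_iff_continuousAt.2 fun s => (hasDerivAt_exp_neg_integral hg t s).continuousAt

/-- If `g` is continuous and nonnegative on `[a, t]`, the resolvent-type integral over `[0, t]`
exceeds the one over `[0, a]` by at most `1`. -/
theorem integral_abs_mul_exp_neg_integral_le_add_one {g : ℝ → ℝ} (hg : Continuous g)
    {a t : ℝ} (ha : 0 ≤ a) (hat : a ≤ t) (hpos : ∀ s ∈ Set.Icc a t, 0 ≤ g s) :
    (∫ s in (0 : ℝ)..t, |g s| * Real.exp (-∫ u in s..t, g u)) ≤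
      (∫ s in (0 : ℝ)..a, |g s| * Real.exp (-∫ u in s..a, g u)) + 1 := by
  have hc : ∀ b : ℝ, Continuous fun s => |g s| * Real.exp (-∫ u in s..b, g u) :=
    fun b => hg.abs.mul (continuous_exp_neg_integral hg b)
  rw [← intervalIntegral.integral_add_adjacent_intervals
    ((hc t).intervalIntegrable 0 a) ((hc t).intervalIntegrable a t)]
  apply add_le_add
  · refine intervalIntegral.integral_mono_on ha ((hc t).intervalIntegrable 0 a)
      ((hc a).intervalIntegrable 0 a) fun s _ => ?_
    have h : 0 ≤ ∫ u in a..t, g u := intervalIntegral.integral_nonneg hat hpos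
    rw [← intervalIntegral.integral_add_adjacent_intervals
      (hg.intervalIntegrable s a) (hg.intervalIntegrable a t)]
    gcongr
    linarith
  · have h : (∫ s in a..t, |g s| * Real.exp (-∫ u in s..t, g u)) =
        ∫ s in a..t, g s * Real.exp (-∫ u in s..t, g u) := by
      refine intervalIntegral.integral_congr fun s hs => ?_
      rw [Set.uIcc_of_le hat] at hs
      simp only [abs_of_nonneg (hpos s hs)]
    rw [h, intervalIntegral.integral_eq_sub_of_hasDerivAt
      (fun s _ => hasDerivAt_exp_neg_integral hg t s)
      ((hg.mul (continuous_exp_neg_integral hg t)).intervalIntegrable a t)]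
    simp [Real.exp_nonneg]

/-- If the continuous function `g` on `[0,∞)` satisfies `m₁ < g < m₂` after time `That` (= T̂),
then for every `t ≥ That` the resolvent-type integral `∫₀ᵗ |g s| e^{-∫ₛᵗ g} ds` is bounded
by `C₁ + m₂/m₁`, where `C₁ = ∫₀^That |g s| e^{-∫ₛ^That g} ds`. -/
theorem resolvent_integral_uniform_bound (g : ℝ → ℝ) (hg : ContinuousOn g (Set.Ici 0))
    (That m₁ m₂ : ℝ) (hThat : 0 ≤ That) (hm₁ : 0 < m₁) (hm₁₂ : m₁ < m₂)
    (hband : ∀ s : ℝ, That ≤ s → m₁ < g s ∧ g s < m₂) :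
    ∀ t : ℝ, That ≤ t →
      (∫ s in (0 : ℝ)..t, |g s| * Real.exp (-∫ u in s..t, g u)) ≤
        (∫ s in (0 : ℝ)..That, |g s| * Real.exp (-∫ u in s..That, g u)) + m₂ / m₁ := by
  intro t ht
  set G : ℝ → ℝ := fun s => g (max s 0) with hG
  have hGc : Continuous G :=
    hg.comp_continuous (by fun_prop) fun s => le_max_right s 0
  have hGg : ∀ s, 0 ≤ s → G s = g s := fun s hs => by simp only [hG, max_eq_left hs]
  have key : ∀ b : ℝ, 0 ≤ b → (∫ s in (0 : ℝ)..b, |g s| * Real.exp (-∫ u in s..b, g u)) =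
      ∫ s in (0 : ℝ)..b, |G s| * Real.exp (-∫ u in s..b, G u) := by
    intro b hb
    refine intervalIntegral.integral_congr fun s hs => ?_
    rw [Set.uIcc_of_le hb] at hs
    have h : (∫ u in s..b, g u) = ∫ u in s..b, G u := by
      refine intervalIntegral.integral_congr fun u hu => ?_
      rw [Set.uIcc_of_le hs.2] at hu
      exact (hGg u (hs.1.trans hu.1)).symm
    simp only [h, hGg s hs.1]
  rw [key t (hThat.trans ht), key That hThat]
  have h1 : 1 ≤ m₂ / m₁ := (one_le_div hm₁).2 hm₁₂.le
  have h2 := integral_abs_mul_exp_neg_integral_le_add_one hGc hThat ht fun s hs => by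
    rw [hGg s (hThat.trans hs.1)]
    exact (hm₁.trans (hband s hs.1).1).le
  linarith
end

section
/- Let g : [0,∞) → ℝ be continuous and suppose there exist T̂ ≥ 0 and 0 < m₁ < m₂ with m₁ < g(s) < m₂ for all s ≥ T̂. Then there exists a constant C_Z ≥ 2, depending only on g, T̂, m₁, m₂, such that for every T > 0 and every bounded measurable ξ : [0,T] → ℝ, the function Z(t) := ξ(t) - ∫₀^t ξ(s) g(s) e^{-∫_s^t g(u) du} ds satisfies sup_{t∈[0,T]} |Z(t)| ≤ C_Z · sup_{t∈[0,T]} |ξ(t)|. -/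
/-- A continuous function on `[0, ∞)` which is eventually bounded is bounded. -/
theorem exists_abs_le_of_continuousOn_of_band {g : ℝ → ℝ} (hg : ContinuousOn g (Set.Ici 0))
    {a m₁ m₂ : ℝ} (hm₁ : 0 < m₁) (hband : ∀ s : ℝ, a ≤ s → m₁ < g s ∧ g s < m₂) :
    ∃ B : ℝ, 0 ≤ B ∧ ∀ s : ℝ, 0 ≤ s → |g s| ≤ B := by
  obtain ⟨K, hK⟩ := (isCompact_Icc (a := (0 : ℝ)) (b := a)).exists_bound_of_continuousOn
    (hg.mono fun x hx => hx.1)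
  have hbound : ∀ s : ℝ, 0 ≤ s → |g s| ≤ max K m₂ := by
    intro s hs
    rcases le_total s a with h | h
    · exact (hK s ⟨hs, h⟩).trans (le_max_left _ _)
    · obtain ⟨h₁, h₂⟩ := hband s h
      rw [abs_of_pos (hm₁.trans h₁)]
      exact h₂.le.trans (le_max_right _ _)
  exact ⟨max K m₂, (abs_nonneg _).trans (hbound 0 le_rfl), hbound⟩

/-- The propagator `exp (-∫ₛᵗ g)` decays exponentially in `t - s` when `g` is bounded below
by a positive constant after a finite time. -/
theorem exp_neg_integral_le {g : ℝ → ℝ} (hg : ContinuousOn g (Set.Ici 0))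
    {a m B : ℝ} (ha : 0 ≤ a) (hm : 0 ≤ m) (hlow : ∀ s : ℝ, a ≤ s → m ≤ g s)
    (hB : 0 ≤ B) (hbound : ∀ s : ℝ, 0 ≤ s → |g s| ≤ B) {s t : ℝ} (hs : 0 ≤ s) (hst : s ≤ t) :
    Real.exp (-∫ u in s..t, g u) ≤ Real.exp ((B + m) * a) * Real.exp (-(m * (t - s))) := by
  have hint : ∀ x y : ℝ, 0 ≤ x → x ≤ y → IntervalIntegrable g MeasureTheory.volume x y := by
    intro x y hx hxy
    apply ContinuousOn.intervalIntegrable_of_Icc hxy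
    exact hg.mono fun u hu => hx.trans hu.1
  obtain ⟨c, hsc, hct, hca, hac⟩ : ∃ c, s ≤ c ∧ c ≤ t ∧ c - s ≤ a ∧ (c < t → a ≤ c) := by
    rcases le_total a s with h | h
    · exact ⟨s, le_rfl, hst, by linarith, fun _ => h⟩
    rcases le_total a t with h' | h'
    · exact ⟨a, h, h', by linarith, fun _ => le_rfl⟩
    · exact ⟨t, hst, le_rfl, by linarith, fun h => absurd h (lt_irrefl t)⟩
  have h₁ : -B * (c - s) ≤ ∫ u in s..c, g u := by
    have := intervalIntegral.integral_mono_on hsc (intervalIntegrable_const (c := -B))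
      (hint s c hs hsc) fun u hu => (abs_le.mp (hbound u (hs.trans hu.1))).1
    rw [intervalIntegral.integral_const, smul_eq_mul] at this
    linarith
  have h₂ : m * (t - c) ≤ ∫ u in c..t, g u := by
    rcases hct.eq_or_lt with rfl | hlt
    · simp
    have := intervalIntegral.integral_mono_on hct (intervalIntegrable_const (c := m))
      (hint c t (hs.trans hsc) hct) fun u hu => hlow u ((hac hlt).trans hu.1)
    rw [intervalIntegral.integral_const, smul_eq_mul] at this
    linarith
  have h₃ := intervalIntegral.integral_add_adjacent_intervals (hint s c hs hsc)
    (hint c t (hs.trans hsc) hct)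
  have h₄ : (B + m) * (c - s) ≤ (B + m) * a := by gcongr
  rw [← Real.exp_add, Real.exp_le_exp, ← h₃]
  linarith

/-- The exponential kernel with rate `m` has total mass at most `1 / m`. -/
theorem integral_exp_neg_mul_sub_le {m : ℝ} (hm : 0 < m) (t : ℝ) :
    ∫ s in (0 : ℝ)..t, Real.exp (-(m * (t - s))) ≤ 1 / m := by
  have hderiv : ∀ s ∈ Set.uIcc 0 t, HasDerivAt (fun s => Real.exp (-(m * (t - s))) / m)
      (Real.exp (-(m * (t - s)))) s := by
    intro s _
    have h : HasDerivAt (fun s => -(m * (t - s))) (-(m * -1)) s :=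
      (((hasDerivAt_id s).const_sub t).const_mul m).neg
    exact (h.exp.div_const m).congr_deriv (by field_simp)
  rw [intervalIntegral.integral_eq_sub_of_hasDerivAt hderiv
    (Continuous.intervalIntegrable (by fun_prop) _ _)]
  have : 0 ≤ Real.exp (-(m * (t - 0))) / m := by positivity
  simpa using this

/-- Lemma 2 of the paper (deterministic content): if the continuous function `g` on
`[0,∞)` satisfies `m₁ < g < m₂` after some time `That`, then there is a constant
`C_Z ≥ 2`, depending only on `g, That, m₁, m₂`, such that for every horizon `T > 0`
and every bounded measurable path `ξ` on `[0,T]` (with bound `M`), the function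
`Z t = ξ t - ∫₀ᵗ ξ s · g s · e^{-∫ₛᵗ g} ds` satisfies `|Z t| ≤ C_Z · M` on `[0,T]`;
with `M = sup |ξ|` this is `sup |Z| ≤ C_Z · sup |ξ|`. -/
theorem first_order_term_sup_bound (g : ℝ → ℝ) (hg : ContinuousOn g (Set.Ici 0))
    (That m₁ m₂ : ℝ) (hThat : 0 ≤ That) (hm₁ : 0 < m₁) (hm₁₂ : m₁ < m₂)
    (hband : ∀ s : ℝ, That ≤ s → m₁ < g s ∧ g s < m₂) :
    ∃ C_Z : ℝ, 2 ≤ C_Z ∧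
      ∀ T : ℝ, 0 < T → ∀ ξ : ℝ → ℝ, Measurable ξ →
        ∀ M : ℝ, (∀ s ∈ Set.Icc (0 : ℝ) T, |ξ s| ≤ M) →
          ∀ t ∈ Set.Icc (0 : ℝ) T,
            |ξ t - ∫ s in (0 : ℝ)..t, ξ s * g s * Real.exp (-∫ u in s..t, g u)|
              ≤ C_Z * M := by
  obtain ⟨B, hB, hbound⟩ := exists_abs_le_of_continuousOn_of_band hg hm₁ hband
  set A := Real.exp ((B + m₁) * That)
  have hA₀ : 0 ≤ A := (Real.exp_pos _).le
  refine ⟨2 + B * A * (1 / m₁), le_add_of_nonneg_right (by positivity), ?_⟩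
  intro T hT ξ _ M hM t ht
  have hM₀ : 0 ≤ M := (abs_nonneg _).trans (hM 0 ⟨le_rfl, hT.le⟩)
  have hintegral : |∫ s in (0 : ℝ)..t, ξ s * g s * Real.exp (-∫ u in s..t, g u)|
      ≤ ∫ s in (0 : ℝ)..t, M * B * A * Real.exp (-(m₁ * (t - s))) := by
    rw [← Real.norm_eq_abs]
    refine intervalIntegral.norm_integral_le_of_norm_le ht.1
      (Filter.Eventually.of_forall fun s hs => ?_)
      (Continuous.intervalIntegrable (by fun_prop) _ _)
    have hexp := exp_neg_integral_le hg hThat hm₁.le (fun s hs => (hband s hs).1.le) hB hbound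
      hs.1.le hs.2
    rw [Real.norm_eq_abs, abs_mul, abs_mul, Real.abs_exp, mul_assoc (M * B)]
    have hξ := hM s ⟨hs.1.le, hs.2.trans ht.2⟩
    have hgs := hbound s hs.1.le
    gcongr
  rw [intervalIntegral.integral_const_mul] at hintegral
  have hmass : M * B * A * (∫ s in (0 : ℝ)..t, Real.exp (-(m₁ * (t - s))))
      ≤ M * B * A * (1 / m₁) :=
    mul_le_mul_of_nonneg_left (integral_exp_neg_mul_sub_le hm₁ t) (by positivity)
  calc |ξ t - ∫ s in (0 : ℝ)..t, ξ s * g s * Real.exp (-∫ u in s..t, g u)|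
      ≤ |ξ t| + |∫ s in (0 : ℝ)..t, ξ s * g s * Real.exp (-∫ u in s..t, g u)| := abs_sub _ _
    _ ≤ M + M * B * A * (1 / m₁) := add_le_add (hM t ht) (hintegral.trans hmass)
    _ ≤ (2 + B * A * (1 / m₁)) * M := by linarith
end

section
/- Let U : ℝ → ℝ be twice continuously differentiable, let a, b, K > 0, and suppose C > 0 satisfies, for all y ∈ [-b, a] and all z ∈ [-K, K], both -U'(y+z+C) + U'(y) + U''(y)·z < 0 and -U'(y+z-C) + U'(y) + U''(y)·z > 0. Let T > 0, let Y : [0,T] → [-b,a] and v : [0,T] → [-K,K] be measurable, and let R : [0,T] → ℝ be continuous with R(0) = 0 and R(t) = ∫₀^t [ -U'(Y(s)+v(s)+R(s)) + U'(Y(s)) + U''(Y(s))·v(s) ] ds for all t ∈ [0,T]. Then |R(t)| ≤ C for all t ∈ [0,T]. -/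
open Set Filter Topology MeasureTheory

/-- A continuous indefinite integral whose integrand is nonpositive whenever the integral is close
to the level `C` cannot cross `C` upwards. -/
theorem le_of_eq_integral_of_eventually_nonpos {f R : ℝ → ℝ} {C T : ℝ}
    (hf : IntegrableOn f (Icc 0 T)) (hRcont : ContinuousOn R (Icc 0 T)) (hR0 : R 0 ≤ C)
    (hR : ∀ t ∈ Icc (0 : ℝ) T, R t = R 0 + ∫ s in (0 : ℝ)..t, f s)
    (hC : ∀ᶠ r in 𝓝 C, ∀ s ∈ Icc (0 : ℝ) T, R s = r → f s ≤ 0) :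
    ∀ t ∈ Icc (0 : ℝ) T, R t ≤ C := by
  have hclosed : IsClosed ({t | R t ≤ C} ∩ Icc 0 T) := by
    rw [inter_comm]
    exact hRcont.preimage_isClosed_of_isClosed isClosed_Icc isClosed_Iic
  refine hclosed.Icc_subset_of_forall_exists_gt hR0 ?_
  rintro x ⟨hxC, hx⟩ y hy
  by_contra hempty
  have habove : ∀ t ∈ Ioc x y, C < R t := fun t ht => by
    by_contra h
    exact hempty ⟨t, not_lt.mp h, ht⟩
  have hxT : x ∈ Icc 0 T := ⟨hx.1, hx.2.le⟩
  have hright : ContinuousWithinAt R (Ioi x) x :=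
    (hRcont x hxT).mono_of_mem_nhdsWithin
      (mem_of_superset (Ioc_mem_nhdsGT hx.2) fun t ht => ⟨hx.1.trans ht.1.le, ht.2⟩)
  have hRx : R x = C := by
    refine le_antisymm hxC (ge_of_tendsto hright ?_)
    filter_upwards [Ioc_mem_nhdsGT hy] with t ht using (habove t ht).le
  have hev : ∀ᶠ t in 𝓝[>] x, f t ≤ 0 := by
    have hright' : Tendsto R (𝓝[>] x) (𝓝 C) := hRx ▸ hright
    filter_upwards [hright'.eventually hC, Ioc_mem_nhdsGT hx.2] with t ht htT
    exact ht t ⟨hx.1.trans htT.1.le, htT.2⟩ rfl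
  obtain ⟨u, hu, hfu⟩ := (mem_nhdsGT_iff_exists_Ioc_subset).mp hev
  set w := min u (min y T)
  have hxw : x < w := lt_min hu (lt_min hy hx.2)
  have hwT : w ∈ Icc 0 T :=
    ⟨hx.1.trans hxw.le, (min_le_right _ _).trans (min_le_right _ _)⟩
  have hint : ∀ {p q : ℝ}, p ∈ Icc 0 T → q ∈ Icc 0 T → IntervalIntegrable f volume p q :=
    fun hp hq => (hf.mono_set (uIcc_subset_Icc hp hq)).intervalIntegrable
  have h0 : (0 : ℝ) ∈ Icc 0 T := ⟨le_rfl, hx.1.trans hx.2.le⟩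
  have hadd := intervalIntegral.integral_add_adjacent_intervals (hint h0 hxT) (hint hxT hwT)
  have hneg : ∫ s in x..w, f s ≤ 0 := by
    rw [intervalIntegral.integral_of_le hxw.le]
    exact setIntegral_nonpos measurableSet_Ioc
      fun t ht => hfu ⟨ht.1, ht.2.trans (min_le_left _ _)⟩
  have hCw := habove w ⟨hxw, (min_le_right _ _).trans (min_le_left _ _)⟩
  linarith [hR x hxT, hR w hwT]

/-- A continuous function of a measurable map into a compact set is integrable on compact sets. -/
theorem integrableOn_comp_of_mem_isCompact {E : Type*} [TopologicalSpace E]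
    {G : E → ℝ} (hG : Continuous G) {S : Set ℝ} (hS : IsCompact S) {L : Set E} (hL : IsCompact L)
    {g : ℝ → E} (hg : AEStronglyMeasurable g (volume.restrict S)) (hgL : ∀ s ∈ S, g s ∈ L) :
    IntegrableOn (fun s => G (g s)) S := by
  obtain ⟨M, hM⟩ := hL.exists_bound_of_continuousOn hG.continuousOn
  refine IntegrableOn.of_bound hS.measure_lt_top (hG.comp_aestronglyMeasurable hg) M ?_
  exact (ae_restrict_mem hS.measurableSet).mono fun s hs => hM _ (hgL s hs)

/-- A strict inequality that holds on a compact slice persists on the nearby slices. -/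
theorem IsCompact.eventually_forall_lt_zero {E : Type*} [TopologicalSpace E] {L : Set E}
    (hL : IsCompact L) {G : E × ℝ → ℝ} (hG : Continuous G) {C : ℝ}
    (h : ∀ p ∈ L, G (p, C) < 0) : ∀ᶠ r in 𝓝 C, ∀ p ∈ L, G (p, r) < 0 := by
  refine hL.eventually_forall_of_forall_eventually fun p hp => ?_
  exact (hG.comp continuous_swap).continuousAt.eventually_lt continuousAt_const (h p hp)

/-- Lemma 3 of the paper (rough boundedness of the remainder): if the barrier
inequalities `-U'(y+z±C) + U'(y) + U''(y)z ≶ 0` hold for `y ∈ [-b,a]`, `z ∈ [-K,K]`,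
then any continuous solution `R` with `R 0 = 0` of the remainder integral equation
`R t = ∫₀ᵗ [-U'(Y+v+R) + U'(Y) + U''(Y)·v]` along measurable `Y : [0,T] → [-b,a]`
and `v : [0,T] → [-K,K]` satisfies `|R t| ≤ C` on `[0,T]`. -/
theorem remainder_rough_bound (U : ℝ → ℝ) (hU : ContDiff ℝ 2 U)
    (a b K C : ℝ) (ha : 0 < a) (hb : 0 < b) (hK : 0 < K) (hC : 0 < C)
    (hbar₁ : ∀ y ∈ Set.Icc (-b) a, ∀ z ∈ Set.Icc (-K) K,
      -deriv U (y + z + C) + deriv U y + deriv (deriv U) y * z < 0)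
    (hbar₂ : ∀ y ∈ Set.Icc (-b) a, ∀ z ∈ Set.Icc (-K) K,
      -deriv U (y + z - C) + deriv U y + deriv (deriv U) y * z > 0)
    (T : ℝ) (hT : 0 < T) (Y v R : ℝ → ℝ)
    (hYm : Measurable Y) (hvm : Measurable v)
    (hY : ∀ s ∈ Set.Icc (0 : ℝ) T, Y s ∈ Set.Icc (-b) a)
    (hv : ∀ s ∈ Set.Icc (0 : ℝ) T, v s ∈ Set.Icc (-K) K)
    (hRcont : ContinuousOn R (Set.Icc 0 T)) (hR0 : R 0 = 0)
    (hR : ∀ t ∈ Set.Icc (0 : ℝ) T, R t = ∫ s in (0 : ℝ)..t,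
      (-deriv U (Y s + v s + R s) + deriv U (Y s) + deriv (deriv U) (Y s) * v s)) :
    ∀ t ∈ Set.Icc (0 : ℝ) T, |R t| ≤ C := by
  set G : (ℝ × ℝ) × ℝ → ℝ := fun p =>
    -deriv U (p.1.1 + p.1.2 + p.2) + deriv U p.1.1 + deriv (deriv U) p.1.1 * p.1.2
  have hU' : ContDiff ℝ 1 (deriv U) := hU.deriv' (n := 1)
  have hU₁ : Continuous (deriv U) := hU'.continuous
  have hU₂ : Continuous (deriv (deriv U)) := hU'.continuous_deriv le_rfl
  have hG : Continuous G := by fun_prop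
  set L : Set (ℝ × ℝ) := Icc (-b) a ×ˢ Icc (-K) K
  have hL : IsCompact L := isCompact_Icc.prod isCompact_Icc
  have hYv : ∀ s ∈ Icc (0 : ℝ) T, (Y s, v s) ∈ L := fun s hs => ⟨hY s hs, hv s hs⟩
  have hf : IntegrableOn (fun s => G ((Y s, v s), R s)) (Icc 0 T) := by
    refine integrableOn_comp_of_mem_isCompact hG isCompact_Icc
      (hL.prod (isCompact_Icc.image_of_continuousOn hRcont)) ?_
      fun s hs => ⟨hYv s hs, mem_image_of_mem R hs⟩
    exact ((hYm.prodMk hvm).aestronglyMeasurable).prodMk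
      (hRcont.aestronglyMeasurable measurableSet_Icc)
  have hupper : ∀ t ∈ Icc (0 : ℝ) T, R t ≤ C := by
    refine le_of_eq_integral_of_eventually_nonpos hf hRcont (hR0.le.trans hC.le)
      (fun t ht => by rw [hR0, zero_add]; exact hR t ht) ?_
    filter_upwards [hL.eventually_forall_lt_zero hG fun p hp => hbar₁ p.1 hp.1 p.2 hp.2]
      with r hr s hs hsr
    rw [hsr]
    exact (hr _ (hYv s hs)).le
  have hlower : ∀ t ∈ Icc (0 : ℝ) T, -R t ≤ C := by
    refine le_of_eq_integral_of_eventually_nonpos (R := fun t => -R t) hf.neg hRcont.neg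
      (by simpa [hR0] using hC.le) (fun t ht => ?_) ?_
    · simp only [Pi.neg_apply, intervalIntegral.integral_neg, hR0, neg_zero, zero_add]
      exact congrArg Neg.neg (hR t ht)
    · have hGneg : Continuous fun p : (ℝ × ℝ) × ℝ => -G (p.1, -p.2) := by fun_prop
      filter_upwards [hL.eventually_forall_lt_zero hGneg
        fun p hp => neg_lt_zero.mpr (hbar₂ p.1 hp.1 p.2 hp.2)] with r hr s hs hsr
      have hneg := hr _ (hYv s hs)
      simp only [← hsr, neg_neg] at hneg
      exact hneg.le
  exact fun t ht => abs_le'.mpr ⟨hupper t ht, hlower t ht⟩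
end

section
/- Let K, L, T > 0 and let U : ℝ → ℝ be three times continuously differentiable with |U''(y)| ≤ L and |U'''(y)| ≤ L for all y ∈ [-K,K]. Let η ≥ 0, let Y : [0,T] → [-K,K] and v : [0,T] → ℝ be measurable with |v(s)| ≤ η for all s, and let R : [0,T] → ℝ be continuous with R(0) = 0, R(t) = ∫₀^t [ -U'(Y(s)+v(s)+R(s)) + U'(Y(s)) + U''(Y(s))·v(s) ] ds, and Y(s)+v(s) ∈ [-K,K] and Y(s)+v(s)+R(s) ∈ [-K,K] for all s ∈ [0,T]. Then sup_{t∈[0,T]} |R(t)| ≤ (1/2)·T·L·η²·e^{T L}. -/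
/-- Second-order Taylor remainder bound on a convex set, with the sharp constant `1 / 2`. -/
theorem Convex.abs_taylor_one_remainder_le {s : Set ℝ} (hs : Convex ℝ s) {g : ℝ → ℝ} {L : ℝ}
    (hg : Differentiable ℝ g) (hg' : Differentiable ℝ (deriv g))
    (hbound : ∀ y ∈ s, |deriv (deriv g) y| ≤ L) {x h : ℝ} (hx : x ∈ s) (hxh : x + h ∈ s) :
    |g (x + h) - g x - deriv g x * h| ≤ L * h ^ 2 / 2 := by
  have hline (t : ℝ) : HasDerivAt (fun t : ℝ => x + t * h) h t := by
    simpa using ((hasDerivAt_id t).mul_const h).const_add x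
  have hf (t : ℝ) : HasDerivAt (fun t : ℝ => g (x + t * h) - g x - deriv g x * (t * h))
      ((deriv g (x + t * h) - deriv g x) * h) t := by
    have h₁ := (hg (x + t * h)).hasDerivAt.comp t (hline t)
    have h₂ := ((hasDerivAt_id t).mul_const h).const_mul (deriv g x)
    convert! (h₁.sub_const (g x)).sub h₂ using 1
    simp
    ring
  have hB (t : ℝ) : HasDerivAt (fun t : ℝ => L * h ^ 2 / 2 * t ^ 2) (L * h ^ 2 * t) t := by
    convert! (hasDerivAt_pow 2 t).const_mul (L * h ^ 2 / 2) using 1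
    simp
    ring
  have key := image_norm_le_of_norm_deriv_right_le_deriv_boundary (a := 0) (b := 1)
    (fun t _ => (hf t).continuousAt.continuousWithinAt) (fun t _ => (hf t).hasDerivWithinAt)
    (by simp) hB
    (fun t ht => ?_) (Set.right_mem_Icc.2 zero_le_one)
  · simpa using key
  · have hmem : x + t * h ∈ s := by
      simpa using hs.add_smul_mem hx hxh ⟨ht.1, ht.2.le⟩
    have hlip := hs.norm_image_sub_le_of_norm_deriv_le (fun y _ => hg' y) hbound hx hmem
    rw [add_sub_cancel_left, norm_mul, Real.norm_eq_abs t, abs_of_nonneg ht.1] at hlip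
    calc ‖(deriv g (x + t * h) - deriv g x) * h‖
        ≤ L * (t * ‖h‖) * ‖h‖ := by rw [norm_mul]; gcongr
      _ = L * ‖h‖ ^ 2 * t := by ring
      _ = L * h ^ 2 * t := by rw [Real.norm_eq_abs, sq_abs]

/-- Integral form of Gronwall's inequality with constant coefficients. -/
theorem le_gronwallBound_of_le_integral {u : ℝ → ℝ} {a b K ε : ℝ} (hK : 0 ≤ K)
    (hu : ContinuousOn u (Set.Icc a b))
    (hle : ∀ t ∈ Set.Icc a b, u t ≤ ∫ s in a..t, (K * u s + ε)) :
    ∀ t ∈ Set.Icc a b, u t ≤ gronwallBound 0 K ε (t - a) := by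
  intro t ht
  have hab : a ≤ b := ht.1.trans ht.2
  set w : ℝ → ℝ := Set.IccExtend hab ((Set.Icc a b).domRestrict u) with hw
  have hwc : Continuous w := hu.domRestrict.Icc_extend'
  have hwu {s : ℝ} (hs : s ∈ Set.Icc a b) : w s = u s := by
    rw [hw, Set.IccExtend_of_mem hab _ hs, Set.domRestrict_apply]
  set G : ℝ → ℝ := fun t => ∫ s in a..t, (K * w s + ε)
  have hG (t : ℝ) : HasDerivAt G (K * w t + ε) t :=
    (by fun_prop : Continuous fun s => K * w s + ε).integral_hasStrictDerivAt a t |>.hasDerivAt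
  have huG {t : ℝ} (ht : t ∈ Set.Icc a b) : u t ≤ G t := by
    refine (hle t ht).trans_eq (intervalIntegral.integral_congr fun s hs => ?_)
    rw [Set.uIcc_of_le ht.1] at hs
    simp only [hwu ⟨hs.1, hs.2.trans ht.2⟩]
  have hslope : ∀ t ∈ Set.Ico a b, ∀ r, K * w t + ε < r →
      ∃ᶠ z in nhdsWithin t (Set.Ioi t), (z - t)⁻¹ * (G z - G t) < r := fun t _ r hr => by
    simpa [slope_def_field, div_eq_inv_mul] using
      (hG t).hasDerivWithinAt.liminf_right_slope_le hr
  have hbound : ∀ t ∈ Set.Ico a b, K * w t + ε ≤ K * G t + ε := fun t ht => by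
    have ht' := Set.Ico_subset_Icc_self ht
    rw [hwu ht']
    gcongr
    exact huG ht'
  exact (huG ht).trans (le_gronwallBound_of_liminf_deriv_right_le
    (fun t _ => (hG t).continuousAt.continuousWithinAt) hslope (by simp [G]) hbound t ht)

theorem gronwallBound_zero_left_le {K ε x : ℝ} (hε : 0 ≤ ε) (hK : 0 < K) :
    gronwallBound 0 K ε x ≤ ε * x * Real.exp (K * x) := by
  have h : Real.exp (K * x) - 1 ≤ K * x * Real.exp (K * x) := by
    have h₁ := mul_le_mul_of_nonneg_right (Real.one_sub_le_exp_neg (K * x))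
      (Real.exp_pos (K * x)).le
    rw [← Real.exp_add, neg_add_cancel, Real.exp_zero] at h₁
    linarith
  calc gronwallBound 0 K ε x = ε / K * (Real.exp (K * x) - 1) := by
        simp [gronwallBound_of_K_ne_0 hK.ne']
    _ ≤ ε / K * (K * x * Real.exp (K * x)) := by gcongr
    _ = ε * x * Real.exp (K * x) := by field_simp

/-- Gronwall estimate for the remainder on a bounded time interval: with
`|U''| ≤ L` and `|U'''| ≤ L` on `[-K,K]`, `|v| ≤ η`, and all relevant arguments
confined to `[-K,K]`, the continuous solution `R` with `R 0 = 0` of the remainder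
integral equation satisfies `|R t| ≤ (1/2)·T·L·η²·e^{TL}` on `[0,T]`. -/
theorem remainder_gronwall_bound (K L T : ℝ) (hK : 0 < K) (hL : 0 < L) (hT : 0 < T)
    (U : ℝ → ℝ) (hU : ContDiff ℝ 3 U)
    (hU'' : ∀ y ∈ Set.Icc (-K) K, |deriv (deriv U) y| ≤ L)
    (hU''' : ∀ y ∈ Set.Icc (-K) K, |deriv (deriv (deriv U)) y| ≤ L)
    (η : ℝ) (hη : 0 ≤ η)
    (Y v R : ℝ → ℝ) (hYm : Measurable Y) (hvm : Measurable v)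
    (hY : ∀ s ∈ Set.Icc (0 : ℝ) T, Y s ∈ Set.Icc (-K) K)
    (hv : ∀ s ∈ Set.Icc (0 : ℝ) T, |v s| ≤ η)
    (hRcont : ContinuousOn R (Set.Icc 0 T)) (hR0 : R 0 = 0)
    (hR : ∀ t ∈ Set.Icc (0 : ℝ) T, R t = ∫ s in (0 : ℝ)..t,
      (-deriv U (Y s + v s + R s) + deriv U (Y s) + deriv (deriv U) (Y s) * v s))
    (hin₁ : ∀ s ∈ Set.Icc (0 : ℝ) T, Y s + v s ∈ Set.Icc (-K) K)
    (hin₂ : ∀ s ∈ Set.Icc (0 : ℝ) T, Y s + v s + R s ∈ Set.Icc (-K) K) :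
    ∀ t ∈ Set.Icc (0 : ℝ) T, |R t| ≤ 1 / 2 * T * L * η ^ 2 * Real.exp (T * L) := by
  have hg : ContDiff ℝ 2 (deriv U) := hU.deriv' (n := 2)
  have hg' : ContDiff ℝ 1 (deriv (deriv U)) := hg.deriv' (n := 1)
  have hintegrand : ∀ s ∈ Set.Icc (0 : ℝ) T,
      ‖-deriv U (Y s + v s + R s) + deriv U (Y s) + deriv (deriv U) (Y s) * v s‖
        ≤ L * |R s| + L * η ^ 2 / 2 := by
    intro s hs
    have hlip := (convex_Icc (-K) K).norm_image_sub_le_of_norm_deriv_le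
      (fun y _ => hg.differentiable (by norm_num) y) hU'' (hin₁ s hs) (hin₂ s hs)
    have htaylor := (convex_Icc (-K) K).abs_taylor_one_remainder_le
      (hg.differentiable (by norm_num)) (hg'.differentiable (by norm_num)) hU'''
      (hY s hs) (hin₁ s hs)
    have hsq : v s ^ 2 ≤ η ^ 2 := sq_le_sq.2 ((hv s hs).trans (le_abs_self η))
    rw [add_sub_cancel_left] at hlip
    calc ‖-deriv U (Y s + v s + R s) + deriv U (Y s) + deriv (deriv U) (Y s) * v s‖
        = ‖(deriv U (Y s + v s + R s) - deriv U (Y s + v s)) +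
            (deriv U (Y s + v s) - deriv U (Y s) - deriv (deriv U) (Y s) * v s)‖ := by
          rw [← norm_neg]; congr 1; ring
      _ ≤ L * |R s| + L * v s ^ 2 / 2 := (norm_add_le _ _).trans (add_le_add hlip htaylor)
      _ ≤ L * |R s| + L * η ^ 2 / 2 := by gcongr
  intro t ht
  have hgronwall := le_gronwallBound_of_le_integral hL.le hRcont.abs
    (ε := L * η ^ 2 / 2) (fun t ht => ?_) t ht
  · have hε : 0 ≤ L * η ^ 2 / 2 := by positivity
    rw [sub_zero] at hgronwall
    calc |R t| ≤ L * η ^ 2 / 2 * t * Real.exp (L * t) :=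
          hgronwall.trans (gronwallBound_zero_left_le hε hL)
      _ ≤ L * η ^ 2 / 2 * T * Real.exp (L * T) := by
          have := ht.2
          gcongr
      _ = 1 / 2 * T * L * η ^ 2 * Real.exp (T * L) := by rw [mul_comm L T]; ring
  · rw [hR t ht]
    refine intervalIntegral.norm_integral_le_of_norm_le ht.1 (.of_forall fun s hs =>
      hintegrand s ⟨hs.1.le, hs.2.trans ht.2⟩) ?_
    refine ContinuousOn.intervalIntegrable_of_Icc ht.1 ?_
    have := hRcont.mono (Set.Icc_subset_Icc_right ht.2)
    fun_prop
end

section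
/- Let a, b > 0 and let U : ℝ → ℝ be three times continuously differentiable with U(0) = 0, U'(y)·y > 0 for all y ≠ 0 and U''(0) > 0; assume that for every K > 0 there exists C₀ > 0 such that -U'(y+z+C₀) + U'(y) + U''(y)z < 0 and -U'(y+z-C₀) + U'(y) + U''(y)z > 0 for all y ∈ [-b,a] and all z ∈ [-K,K]. Then there exists a constant C_Z ≥ 2 and, for every c > 0 and γ > 0, an ε₀ > 0 such that for all 0 < ε ≤ ε₀, all x ∈ [-b,a], all T > 0, every differentiable Y : [0,∞) → [-b,a] with Y(0) = x and Y'(t) = -U'(Y(t)), every bounded measurable ζ : [0,T] → ℝ with ζ(0) = 0, and every bounded measurable x̃ : [0,T] → ℝ with x̃(t) = x - ∫₀^t U'(x̃(s)) ds + ζ(t) for all t ∈ [0,T]: if sup_{t∈[0,T]} |ζ(t)| < c·ε^γ/(2 C_Z), then sup_{t∈[0,T]} |x̃(t) - Y(t)| < c·ε^γ. -/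
open Set Filter Topology MeasureTheory

/-- If `u` starts below `G` and returns strictly below `G` immediately after each contact time,
then `u` stays below `G`. -/
theorem le_on_Icc_of_eventually_lt_of_eq {u G : ℝ → ℝ} {T : ℝ}
    (hu : ContinuousOn u (Icc 0 T)) (hG : ContinuousOn G (Icc 0 T)) (h0 : u 0 ≤ G 0)
    (h : ∀ t ∈ Ico 0 T, u t = G t → ∀ᶠ z in 𝓝[>] t, u z < G z) :
    ∀ t ∈ Icc 0 T, u t ≤ G t := by
  have hclosed : IsClosed ({t | u t ≤ G t} ∩ Icc 0 T) := by
    have := isClosed_Icc.isClosed_le hu hG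
    rwa [inter_comm]
  refine hclosed.Icc_subset_of_forall_exists_gt h0 ?_
  rintro t ⟨hle, ht⟩ y hy
  have hev : ∀ᶠ z in 𝓝[>] t, u z ≤ G z := by
    rcases (show u t ≤ G t from hle).eq_or_lt with heq | hlt
    · exact (h t ht heq).mono fun z hz => hz.le
    · have hmono : 𝓝[>] t ≤ 𝓝[Icc 0 T] t :=
        nhdsWithin_le_of_mem (mem_of_superset (Ioc_mem_nhdsGT ht.2)
          fun z hz => ⟨ht.1.trans hz.1.le, hz.2⟩)
      have htI : t ∈ Icc 0 T := ⟨ht.1, ht.2.le⟩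
      exact (((hu t htI).mono_left hmono).eventually_lt ((hG t htI).mono_left hmono) hlt).mono
        fun z hz => hz.le
  obtain ⟨z, hz, hzy⟩ := (hev.and (Ioc_mem_nhdsGT hy)).exists
  exact ⟨z, hz, hzy⟩

/-- A continuously differentiable `f` vanishing only at `0`, with the sign of its argument and with
`f' 0 > 0`, satisfies a monotonicity estimate uniform on `[-b, a]` once it is corrected by a
multiple of `y * f y`. -/
theorem exists_uniform_weighted_monotonicity {f f' : ℝ → ℝ} {a b : ℝ} (ha : 0 < a) (hb : 0 < b)
    (hf : ∀ y, HasDerivAt f (f' y) y) (hf' : Continuous f')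
    (hsign : ∀ y, y ≠ 0 → 0 < f y * y) (h0 : 0 < f' 0) :
    ∃ L > 0, ∃ m > 0, ∃ r > 0, r ≤ 1 ∧ ∃ l ≥ 0,
      (∀ p ∈ Icc (-(a + b + 2)) (a + b + 2), ∀ q ∈ Icc (-(a + b + 2)) (a + b + 2),
        |f p - f q| ≤ L * |p - q|) ∧
      ∀ y ∈ Icc (-b) a, ∀ d, |d| ≤ r →
        m * d ^ 2 ≤ d * (f (y + d) - f y) + l * (y * f y) * d ^ 2 := by
  have hfc : Continuous f := continuous_iff_continuousAt.2 fun y => (hf y).continuousAt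
  obtain ⟨L₀, hL₀⟩ := (isCompact_Icc (a := -(a + b + 2)) (b := a + b + 2)
    ).exists_bound_of_continuousOn hf'.continuousOn
  set L := max L₀ 1
  have hLpos : 0 < L := lt_of_lt_of_le one_pos (le_max_right _ _)
  have hLb : ∀ p ∈ Icc (-(a + b + 2)) (a + b + 2), ‖f' p‖ ≤ L :=
    fun p hp => (hL₀ p hp).trans (le_max_left _ _)
  have hnear : ∀ᶠ y in 𝓝 (0 : ℝ), f' 0 / 2 < f' y :=
    hf'.continuousAt.eventually (lt_mem_nhds (half_lt_self h0))
  obtain ⟨s, hs, hsb⟩ := Metric.eventually_nhds_iff.1 hnear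
  set r := min (s / 3) 1
  have hrpos : 0 < r := lt_min (by positivity) one_pos
  have hrs : r ≤ s / 3 := min_le_left _ _
  have hr1 : r ≤ 1 := min_le_right _ _
  obtain ⟨κ, hκ, hκb⟩ : ∃ κ, 0 < κ ∧ ∀ y ∈ Icc (-b) a ∩ {y | r ≤ |y|}, κ ≤ f y * y :=
    (isCompact_Icc.inter_right (isClosed_le continuous_const continuous_abs)).exists_forall_le'
      (hfc.mul continuous_id).continuousOn
      (fun y hy => hsign y (abs_pos.1 (hrpos.trans_le hy.2)))
  set l := (L + f' 0 / 2) / κ with hl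
  have hlpos : 0 ≤ l := by positivity
  refine ⟨L, hLpos, f' 0 / 2, half_pos h0, r, hrpos, hr1, l, hlpos, ?_, ?_⟩
  · intro p hp q hq
    simpa [Real.norm_eq_abs] using
      (convex_Icc _ _).norm_image_sub_le_of_norm_hasDerivWithin_le
        (fun z _ => (hf z).hasDerivWithinAt) hLb hq hp
  · intro y hy d hd
    have hd' := abs_le.1 hd
    have hyf : 0 ≤ y * f y := by
      rcases eq_or_ne y 0 with rfl | hy0
      · simp
      · linarith [hsign y hy0]
    have key : ∀ ξ, |ξ - y| ≤ r → f' 0 / 2 ≤ f' ξ + l * (y * f y) := by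
      intro ξ hξ
      have hξ' := abs_le.1 hξ
      rcases le_or_gt r |y| with hry | hry
      · have h1 : L + f' 0 / 2 ≤ l * (y * f y) := by
          have h2 : l * κ = L + f' 0 / 2 := by rw [hl]; field_simp
          rw [← h2, mul_comm y]
          exact mul_le_mul_of_nonneg_left (hκb y ⟨hy, hry⟩) hlpos
        have h3 := (abs_le.1 (hLb ξ ⟨by linarith [hy.1], by linarith [hy.2]⟩)).1
        linarith
      · have hy' := abs_lt.1 hry
        have : f' 0 / 2 < f' ξ := hsb (by
          rw [Real.dist_eq, sub_zero, abs_lt]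
          constructor <;> linarith)
        nlinarith [mul_nonneg hlpos hyf]
    have hg : ∀ ξ, HasDerivAt (fun ξ => f ξ + l * (y * f y) * ξ) (f' ξ + l * (y * f y)) ξ :=
      fun ξ => (hf ξ).add (by simpa using (hasDerivAt_id ξ).const_mul (l * (y * f y)))
    have hgc : ContinuousOn (fun ξ => f ξ + l * (y * f y) * ξ) (Icc (y - r) (y + r)) := by fun_prop
    have hslope := (convex_Icc (y - r) (y + r)).mul_sub_le_image_sub_of_le_deriv hgc
      (fun ξ _ => (hg ξ).differentiableAt.differentiableWithinAt)
      (C := f' 0 / 2) (fun ξ hξ => by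
        rw [(hg ξ).deriv]
        have := interior_subset hξ
        exact key ξ (abs_le.2 ⟨by linarith [this.1], by linarith [this.2]⟩))
    have hyI : y ∈ Icc (y - r) (y + r) := ⟨by linarith, by linarith⟩
    have hydI : y + d ∈ Icc (y - r) (y + r) := ⟨by linarith, by linarith⟩
    rcases le_total 0 d with h | h
    · have := hslope y hyI (y + d) hydI (by linarith)
      nlinarith [mul_le_mul_of_nonneg_left this h]
    · have := hslope (y + d) hydI y hyI (by linarith)
      nlinarith [mul_le_mul_of_nonneg_left this (neg_nonneg.2 h)]

/-- One-sided deviation bound between a perturbed trajectory, with the perturbation subtracted, and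
an unperturbed one; `σ = 1` gives the upper and `σ = -1` the lower bound. -/
theorem signed_deviation_le {f : ℝ → ℝ} {a b L m r l β M x T σ : ℝ}
    (ha : 0 < a) (hb : 0 < b) (hL : 0 < L) (hm : 0 < m) (hr1 : r ≤ 1) (hl : 0 ≤ l)
    (hσ : σ = 1 ∨ σ = -1)
    (hLip : ∀ p ∈ Icc (-(a + b + 2)) (a + b + 2), ∀ q ∈ Icc (-(a + b + 2)) (a + b + 2),
      |f p - f q| ≤ L * |p - q|)
    (hmono : ∀ y ∈ Icc (-b) a, ∀ d, |d| ≤ r →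
      m * d ^ 2 ≤ d * (f (y + d) - f y) + l * (y * f y) * d ^ 2)
    (hβ : 0 < β) (hβr : β ≤ r) (hM : M ≤ 1 / 2)
    (hMβ : L * M < m * (β * Real.exp (-(l * (a + b) ^ 2 / 2))))
    {Y w X : ℝ → ℝ} (hY0 : Y 0 = x) (hY : ∀ t, 0 ≤ t → HasDerivAt Y (-f (Y t)) t)
    (hYm : ∀ t, 0 ≤ t → Y t ∈ Icc (-b) a)
    (hint : IntegrableOn (fun s => f (X s)) (Icc 0 T))
    (hw : ∀ t, w t = x - ∫ s in (0 : ℝ)..t, f (X s))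
    (hXw : ∀ t ∈ Icc 0 T, |X t - w t| ≤ M) :
    ∀ t ∈ Icc 0 T, σ * (w t - Y t) ≤ β := by
  have hσ2 : σ * σ = 1 := by rcases hσ with rfl | rfl <;> norm_num
  have hσabs : |σ| = 1 := by rcases hσ with rfl | rfl <;> norm_num
  set B : ℝ → ℝ := fun t => β * Real.exp (-(l * Y t ^ 2 / 2)) with hB
  have hBle : ∀ t, B t ≤ β := fun t =>
    mul_le_of_le_one_right hβ.le (Real.exp_le_one_iff.2
      (by linarith [mul_nonneg hl (sq_nonneg (Y t))]))
  have hBpos : ∀ t, 0 < B t := fun t => by positivity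
  have hBge : ∀ t, 0 ≤ t → β * Real.exp (-(l * (a + b) ^ 2 / 2)) ≤ B t := by
    intro t ht
    have hYt := hYm t ht
    have : Y t ^ 2 ≤ (a + b) ^ 2 := sq_le_sq' (by linarith [hYt.1]) (by linarith [hYt.2])
    simp only [hB]
    gcongr
  have hBd : ∀ t, 0 ≤ t → HasDerivAt B (l * (Y t * f (Y t)) * B t) t := by
    intro t ht
    have := (((((hY t ht).pow 2).const_mul l).div_const 2).neg.exp).const_mul β
    refine this.congr_deriv ?_
    simp only [hB, Pi.pow_apply, Pi.neg_apply]
    push_cast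
    ring
  set G : ℝ → ℝ := fun t => σ * Y t + B t with hG
  have hGd : ∀ t, 0 ≤ t → HasDerivAt G (σ * -f (Y t) + l * (Y t * f (Y t)) * B t) t :=
    fun t ht => ((hY t ht).const_mul σ).add (hBd t ht)
  have hwc : ContinuousOn w (Icc 0 T) := by
    rcases lt_or_ge T 0 with hT | hT
    · simp [Icc_eq_empty (not_le.2 hT)]
    · rw [funext hw]
      have := intervalIntegral.continuousOn_primitive_interval (μ := volume) (a := 0) (b := T)
        (f := fun s => f (X s)) (by rwa [uIcc_of_le hT])
      rw [uIcc_of_le hT] at this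
      exact continuousOn_const.sub this
  have hle : ∀ t ∈ Icc 0 T, σ * w t ≤ G t := by
    refine le_on_Icc_of_eventually_lt_of_eq (continuousOn_const.mul hwc)
      (fun t ht => (hGd t ht.1).continuousAt.continuousWithinAt) ?_ ?_
    · simp only [hG, hw 0, hY0, intervalIntegral.integral_same, sub_zero]
      linarith [hBpos 0]
    intro t ht heq
    have htI : t ∈ Icc 0 T := ⟨ht.1, ht.2.le⟩
    have hdev : w t - Y t = σ * B t := by
      have : σ * (w t - Y t) = B t := by simp only [hG] at heq; linarith
      rw [← this, ← mul_assoc, hσ2, one_mul]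
    have hYt := hYm t ht.1
    have hdr : |σ * B t| ≤ r := by
      rw [abs_mul, hσabs, one_mul, abs_of_pos (hBpos t)]
      exact (hBle t).trans hβr
    have hdrift : m * B t ≤ σ * (f (w t) - f (Y t)) + l * (Y t * f (Y t)) * B t := by
      have h := hmono (Y t) hYt (σ * B t) hdr
      rw [← hdev, add_sub_cancel, hdev, mul_pow, sq σ, hσ2] at h
      refine le_of_mul_le_mul_right ?_ (hBpos t)
      nlinarith
    set q := m * (β * Real.exp (-(l * (a + b) ^ 2 / 2))) with hq
    have hqB : q ≤ m * B t := mul_le_mul_of_nonneg_left (hBge t ht.1) hm.le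
    set η := (q - L * M) / 2 with hη
    have hηpos : 0 < η := by linarith
    set A := -σ * f (w t) + L * M + η with hA
    have hAG : A < σ * -f (Y t) + l * (Y t * f (Y t)) * B t := by linarith
    have hGslope : ∀ᶠ z in 𝓝[>] t, A < slope G t z :=
      ((hasDerivAt_iff_tendsto_slope.1 (hGd t ht.1)).mono_left
        (nhdsWithin_mono t fun z hz => ne_of_gt hz)).eventually (lt_mem_nhds hAG)
    have hwnear : ∀ᶠ z in 𝓝[>] t, |w z - w t| < min (1 / 2) (η / L) := by
      have hmono : 𝓝[>] t ≤ 𝓝[Icc 0 T] t :=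
        nhdsWithin_le_of_mem (mem_of_superset (Ioc_mem_nhdsGT ht.2)
          fun z hz => ⟨ht.1.trans hz.1.le, hz.2⟩)
      have := Metric.tendsto_nhds.1 ((hwc t htI).mono_left hmono) (min (1 / 2) (η / L))
        (lt_min (by norm_num) (by positivity))
      simpa [Real.dist_eq] using this
    obtain ⟨v, hv, hvb⟩ := mem_nhdsGT_iff_exists_Ioc_subset.1
      (hwnear.and (Ioc_mem_nhdsGT ht.2))
    filter_upwards [hGslope, Ioc_mem_nhdsGT hv] with z hz hzv
    have htz : t < z := hzv.1
    have hzT : z ≤ T := (hvb hzv).2.2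
    have hsub : ∀ c d, 0 ≤ c → c ≤ d → d ≤ T →
        IntervalIntegrable (fun s => f (X s)) volume c d := fun c d hc hcd hd =>
      (intervalIntegrable_iff_integrableOn_Ioc_of_le hcd).2
        (hint.mono_set fun s hs => ⟨hc.trans hs.1.le, hs.2.trans hd⟩)
    have hbound : ∀ s ∈ Ioc t z, -σ * f (X s) ≤ A := by
      intro s hs
      have hs' := hvb ⟨hs.1, hs.2.trans hzv.2⟩
      have h1 := lt_min_iff.1 hs'.1
      have h2 := hXw s ⟨ht.1.trans hs.1.le, hs.2.trans hzT⟩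
      have hXwt : |X s - w t| ≤ M + |w s - w t| := (abs_sub_le _ (w s) _).trans (by linarith)
      have h3 := abs_le.1 (hXwt.trans (add_le_add hM h1.1.le))
      have h4 := abs_le.1 (hdr.trans hr1)
      have h5 := hLip (X s) ⟨by linarith [hYt.1], by linarith [hYt.2]⟩ (w t)
        ⟨by linarith [hYt.1], by linarith [hYt.2]⟩
      have h6 : L * |X s - w t| ≤ L * M + η := by
        have := mul_le_mul_of_nonneg_left (hXwt.trans (add_le_add_right h1.2.le M)) hL.le
        rwa [mul_add, mul_div_cancel₀ _ hL.ne'] at this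
      have h7 : -σ * (f (X s) - f (w t)) ≤ |f (X s) - f (w t)| := by
        refine (le_abs_self _).trans ?_
        rw [abs_mul, abs_neg, hσabs, one_mul]
      linarith
    have hwz : σ * w z - σ * w t = ∫ s in t..z, -σ * f (X s) := by
      rw [intervalIntegral.integral_const_mul, hw z, hw t,
        ← intervalIntegral.integral_add_adjacent_intervals (hsub 0 t le_rfl ht.1 ht.2.le)
          (hsub t z ht.1 htz.le hzT)]
      ring
    have hwA : σ * w z - σ * w t ≤ A * (z - t) := by
      rw [hwz]
      have := intervalIntegral.integral_mono_on_of_le_Ioo htz.le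
        ((hsub t z ht.1 htz.le hzT).const_mul (-σ)) (intervalIntegrable_const (c := A))
        (fun s hs => hbound s ⟨hs.1, hs.2.le⟩)
      simpa [mul_comm] using this
    rw [slope_def_field, lt_div_iff₀ (sub_pos.2 htz)] at hz
    linarith
  intro t ht
  have := hle t ht
  simp only [hG] at this
  linarith [hBle t]


/-- Pathwise core of Lemma 1 / Proposition 1 of the paper: there is a constant
`C_Z ≥ 2` such that for every `c, γ > 0` there is `ε₀ > 0` so that for `0 < ε ≤ ε₀`,
whenever the noise path `ζ` satisfies `sup_{[0,T]} |ζ| < c ε^γ/(2 C_Z)` (expressed by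
a bound `M`), the perturbed trajectory `x'` of `ẋ = -U'(x) + ζ̇` started at
`x ∈ [-b,a]` stays within `c ε^γ` of the deterministic trajectory `Y`, in the strong
sense `sup_{[0,T]} |x' - Y| < c ε^γ` (expressed by a bound `M' < c ε^γ`). -/
theorem pathwise_deviation_bound (a b : ℝ) (ha : 0 < a) (hb : 0 < b)
    (U : ℝ → ℝ) (hU : ContDiff ℝ 3 U) (hU0 : U 0 = 0)
    (hsign : ∀ y : ℝ, y ≠ 0 → deriv U y * y > 0)
    (hcurv : 0 < deriv (deriv U) 0)
    (hbar : ∀ K : ℝ, 0 < K → ∃ C₀ : ℝ, 0 < C₀ ∧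
      ∀ y ∈ Set.Icc (-b) a, ∀ z ∈ Set.Icc (-K) K,
        (-deriv U (y + z + C₀) + deriv U y + deriv (deriv U) y * z < 0) ∧
        (-deriv U (y + z - C₀) + deriv U y + deriv (deriv U) y * z > 0)) :
    ∃ C_Z : ℝ, 2 ≤ C_Z ∧
      ∀ c : ℝ, 0 < c → ∀ γ : ℝ, 0 < γ → ∃ ε₀ : ℝ, 0 < ε₀ ∧
        ∀ ε : ℝ, 0 < ε → ε ≤ ε₀ →
          ∀ x ∈ Set.Icc (-b) a, ∀ T : ℝ, 0 < T →
            ∀ Y : ℝ → ℝ, Y 0 = x →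
              (∀ t : ℝ, 0 ≤ t → HasDerivAt Y (-deriv U (Y t)) t) →
              (∀ t : ℝ, 0 ≤ t → Y t ∈ Set.Icc (-b) a) →
              ∀ ζ x' : ℝ → ℝ, Measurable ζ → Measurable x' → ζ 0 = 0 →
                (∃ Mx : ℝ, ∀ t ∈ Set.Icc (0 : ℝ) T, |x' t| ≤ Mx) →
                (∀ t ∈ Set.Icc (0 : ℝ) T,
                  x' t = x - (∫ s in (0 : ℝ)..t, deriv U (x' s)) + ζ t) →
                (∃ M : ℝ, M < c * ε ^ γ / (2 * C_Z) ∧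
                  ∀ t ∈ Set.Icc (0 : ℝ) T, |ζ t| ≤ M) →
                ∃ M' : ℝ, M' < c * ε ^ γ ∧
                  ∀ t ∈ Set.Icc (0 : ℝ) T, |x' t - Y t| ≤ M' := by
  have hU' : ContDiff ℝ 2 (deriv U) :=
    ((contDiff_succ_iff_deriv (n := 2)).1 (by norm_num; exact hU)).2.2
  have hf : ∀ y, HasDerivAt (deriv U) (deriv (deriv U) y) y :=
    fun y => (hU'.differentiable (by norm_num) y).hasDerivAt
  obtain ⟨L, hL, m, hm, r, hr, hr1, l, hl, hLip, hmono⟩ :=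
    exists_uniform_weighted_monotonicity ha hb hf (hU'.continuous_deriv (by norm_num))
      hsign hcurv
  set e := Real.exp (-(l * (a + b) ^ 2 / 2)) with he
  have hepos : 0 < e := Real.exp_pos _
  refine ⟨2 + L / (m * e), by linarith [show 0 < L / (m * e) by positivity], ?_⟩
  intro c hc γ hγ
  refine ⟨(2 * r / c) ^ (1 / γ), by positivity, ?_⟩
  intro ε hε hεle x hx T hT Y hY0 hY hYm ζ X hζ hX hζ0 hXb hXeq hζb
  obtain ⟨M, hM, hζM⟩ := hζb
  obtain ⟨Mx, hMx⟩ := hXb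
  set δ := c * ε ^ γ with hδ
  have hδpos : 0 < δ := by positivity
  have hδr : δ ≤ 2 * r := by
    have h := Real.rpow_le_rpow hε.le hεle hγ.le
    rw [← Real.rpow_mul (by positivity), one_div_mul_cancel hγ.ne', Real.rpow_one,
      le_div_iff₀ hc] at h
    rw [hδ]
    linarith
  have hM0 : 0 ≤ M := (abs_nonneg _).trans (hζM 0 ⟨le_rfl, hT.le⟩)
  have hMC : M * (4 + 2 * (L / (m * e))) < δ := by
    rw [lt_div_iff₀ (by positivity)] at hM
    linarith
  have hM4 : M * 4 < δ := by
    have : 0 ≤ M * (L / (m * e)) := by positivity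
    linarith
  have hLM : L * M < m * (δ / 2 * e) := by
    have h1 : M * (L / (m * e)) < δ / 2 := by linarith
    rw [← mul_div_assoc, div_lt_iff₀ (by positivity)] at h1
    linarith
  have hint : IntegrableOn (fun s => deriv U (X s)) (Icc 0 T) := by
    obtain ⟨C, hC⟩ := (isCompact_Icc (a := -Mx) (b := Mx)).exists_bound_of_continuousOn
      hU'.continuous.continuousOn
    refine Measure.integrableOn_of_bounded (M := C) (by simp)
      (hU'.continuous.measurable.comp hX).aestronglyMeasurable ?_
    filter_upwards [ae_restrict_mem measurableSet_Icc] with s hs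
    exact hC _ (abs_le.1 (hMx s hs))
  set w : ℝ → ℝ := fun t => x - ∫ s in (0 : ℝ)..t, deriv U (X s) with hw
  have hXw : ∀ t ∈ Icc 0 T, |X t - w t| ≤ M := by
    intro t ht
    rw [hXeq t ht, hw]
    simpa using hζM t ht
  have hdev : ∀ σ : ℝ, σ = 1 ∨ σ = -1 → ∀ t ∈ Icc 0 T, σ * (w t - Y t) ≤ δ / 2 :=
    fun σ hσ => signed_deviation_le ha hb hL hm hr1 hl hσ hLip hmono (half_pos hδpos)
      (by linarith) (by linarith) hLM hY0 hY hYm hint (fun _ => rfl) hXw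
  refine ⟨δ / 2 + M, by linarith, fun t ht => ?_⟩
  have h1 := hdev 1 (Or.inl rfl) t ht
  have h2 := hdev (-1) (Or.inr rfl) t ht
  have h3 := abs_le.1 (hXw t ht)
  exact abs_le.2 ⟨by linarith, by linarith⟩
end

section
/- Let a, b > 0 and let U : ℝ → ℝ be continuously differentiable with U'(y)·y > 0 for all y ∈ [-b,a] \ {0}. Let 0 < δ < min(a,b) and set T̂ := max{ ∫_{δ}^{a} dy/U'(y), ∫_{-b}^{-δ} dy/(-U'(y)) }. Then every differentiable Y : [0,∞) → ℝ with Y(0) ∈ [-b,a] and Y'(t) = -U'(Y(t)) for all t satisfies Y(t) ∈ [-b,a] for all t ≥ 0 and |Y(t)| ≤ δ for all t ≥ T̂. -/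
open Set

/-- A level `c` at which the drift `-g` points downwards cannot be crossed upwards. -/
theorem le_of_hasDerivAt_neg_of_pos {g Y : ℝ → ℝ} {c s t : ℝ} (hc : 0 < g c)
    (hs : 0 ≤ s) (hst : s ≤ t) (hYs : Y s ≤ c)
    (hY : ∀ t : ℝ, 0 ≤ t → HasDerivAt Y (-g (Y t)) t) : Y t ≤ c := by
  refine image_le_of_deriv_right_lt_deriv_boundary (f := Y) (f' := fun t => -g (Y t))
    (B := fun _ => c) (B' := fun _ => 0) (a := s) (b := t)
    (fun x hx => (hY x (hs.trans hx.1)).continuousAt.continuousWithinAt)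
    (fun x hx => (hY x (hs.trans hx.1)).hasDerivWithinAt) hYs
    (fun x => hasDerivAt_const x c) (fun x _ hxc => ?_) (right_mem_Icc.2 hst)
  have : Y x = c := hxc
  simpa [this] using hc

/-- Separation of variables for `Ẏ = -g(Y)` along a trajectory on which `g` does not vanish. -/
theorem integral_one_div_eq_of_hasDerivAt_neg {g Y : ℝ → ℝ} {t : ℝ} (hg : Continuous g)
    (ht : 0 ≤ t) (hY : ∀ t : ℝ, 0 ≤ t → HasDerivAt Y (-g (Y t)) t)
    (hne : ∀ s ∈ Icc 0 t, g (Y s) ≠ 0) : ∫ y in Y t..Y 0, 1 / g y = t := by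
  have hcont : ContinuousOn Y (uIcc 0 t) := by
    rw [uIcc_of_le ht]
    exact fun x hx => (hY x hx.1).continuousAt.continuousWithinAt
  have hsubst := intervalIntegral.integral_comp_mul_deriv'' (a := 0) (b := t) (f := Y)
    (f' := fun t => -g (Y t)) (g := fun y => 1 / g y) hcont
    (fun x hx => by
      rw [min_eq_left ht] at hx
      exact (hY x hx.1.le).hasDerivWithinAt)
    (hg.comp_continuousOn hcont).neg
    (by
      refine continuousOn_const.div hg.continuousOn ?_
      rintro _ ⟨s, hs, rfl⟩
      rw [uIcc_of_le ht] at hs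
      exact hne s hs)
  have hconst : ∫ s in (0 : ℝ)..t, ((fun y => 1 / g y) ∘ Y) s * -g (Y s) =
      ∫ _ in (0 : ℝ)..t, (-1 : ℝ) := by
    refine intervalIntegral.integral_congr fun s hs => ?_
    rw [uIcc_of_le ht] at hs
    have := hne s hs
    simp only [Function.comp_apply]
    field_simp
  rw [hconst, intervalIntegral.integral_const] at hsubst
  rw [intervalIntegral.integral_symm, ← hsubst]
  simp

/-- A trajectory of `Ẏ = -g(Y)` started below `a` is below `δ` after the time
`∫_δ^a dy / g(y)`. -/
theorem le_of_integral_one_div_le {g Y : ℝ → ℝ} {δ a t : ℝ} (hg : Continuous g)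
    (hδa : δ < a) (hpos : ∀ y ∈ Icc δ a, 0 < g y) (hY0 : Y 0 ≤ a)
    (hY : ∀ t : ℝ, 0 ≤ t → HasDerivAt Y (-g (Y t)) t) (ht : 0 ≤ t)
    (hT : ∫ y in δ..a, 1 / g y ≤ t) : Y t ≤ δ := by
  by_contra! hlt
  have hmem : ∀ s ∈ Icc 0 t, Y s ∈ Icc δ a := fun s hs => by
    refine ⟨?_, le_of_hasDerivAt_neg_of_pos (hpos a ⟨hδa.le, le_rfl⟩) le_rfl hs.1 hY0 hY⟩
    by_contra! hYs
    exact hlt.not_ge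
      (le_of_hasDerivAt_neg_of_pos (hpos δ ⟨le_rfl, hδa.le⟩) hs.1 hs.2 hYs.le hY)
  have hsep := integral_one_div_eq_of_hasDerivAt_neg hg ht hY
    fun s hs => (hpos _ (hmem s hs)).ne'
  have hY0mem := hmem 0 ⟨le_rfl, ht⟩
  have hYtmem := hmem t ⟨ht, le_rfl⟩
  have hint : ∀ x ∈ Icc δ a, ∀ y ∈ Icc δ a,
      IntervalIntegrable (fun y => 1 / g y) MeasureTheory.volume x y := fun x hx y hy =>
    (continuousOn_const.div hg.continuousOn fun z hz =>
      (hpos z (uIcc_subset_Icc hx hy hz)).ne').intervalIntegrable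
  have hδmem : δ ∈ Icc δ a := ⟨le_rfl, hδa.le⟩
  have hamem : a ∈ Icc δ a := ⟨hδa.le, le_rfl⟩
  have hfirst : 0 < ∫ y in δ..Y t, 1 / g y :=
    intervalIntegral.intervalIntegral_pos_of_pos_on (hint δ hδmem _ hYtmem)
      (fun y hy => one_div_pos.2 (hpos y ⟨hy.1.le, hy.2.le.trans hYtmem.2⟩)) hlt
  have hlast : 0 ≤ ∫ y in Y 0..a, 1 / g y :=
    intervalIntegral.integral_nonneg hY0
      fun y hy => (one_div_pos.2 (hpos y ⟨hY0mem.1.trans hy.1, hy.2⟩)).le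
  have hadd₁ := intervalIntegral.integral_add_adjacent_intervals
    (hint δ hδmem _ hYtmem) (hint _ hYtmem _ hY0mem)
  have hadd₂ := intervalIntegral.integral_add_adjacent_intervals
    (hint δ hδmem _ hY0mem) (hint _ hY0mem a hamem)
  linarith

/-- Relaxation of the deterministic dynamics `Ẏ = -U'(Y)`: under `U'(y)·y > 0` on
`[-b,a] \ {0}`, every trajectory started in `[-b,a]` stays in `[-b,a]` and is inside
the `δ`-neighbourhood of `0` after the deterministic time
`T̂ = max { ∫_δ^a dy/U'(y), ∫_{-b}^{-δ} dy/(-U'(y)) }`. -/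
theorem deterministic_relaxation_time (a b : ℝ) (ha : 0 < a) (hb : 0 < b)
    (U : ℝ → ℝ) (hU : ContDiff ℝ 1 U)
    (hsign : ∀ y ∈ Set.Icc (-b) a, y ≠ 0 → deriv U y * y > 0)
    (δ : ℝ) (hδ0 : 0 < δ) (hδ : δ < min a b)
    (Y : ℝ → ℝ) (hY0 : Y 0 ∈ Set.Icc (-b) a)
    (hYd : ∀ t : ℝ, 0 ≤ t → HasDerivAt Y (-deriv U (Y t)) t) :
    (∀ t : ℝ, 0 ≤ t → Y t ∈ Set.Icc (-b) a) ∧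
    (∀ t : ℝ,
      max (∫ y in Set.Icc δ a, 1 / deriv U y)
          (∫ y in Set.Icc (-b) (-δ), 1 / (-deriv U y)) ≤ t →
      |Y t| ≤ δ) := by
  have hg : Continuous (deriv U) := hU.continuous_deriv le_rfl
  obtain ⟨hδa, hδb⟩ := lt_min_iff.1 hδ
  have hpos : ∀ y ∈ Icc δ a, 0 < deriv U y := fun y hy => by
    have hy0 : 0 < y := hδ0.trans_le hy.1
    exact pos_of_mul_pos_left (hsign y ⟨by linarith, hy.2⟩ hy0.ne') hy0.le
  have hneg : ∀ y ∈ Icc δ b, 0 < -deriv U (-y) := fun y hy => by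
    have hy0 : 0 < y := hδ0.trans_le hy.1
    have := hsign (-y) ⟨by linarith [hy.2], by linarith⟩ (by linarith)
    refine pos_of_mul_pos_left (b := y) ?_ hy0.le
    linarith
  have hYneg : ∀ t : ℝ, 0 ≤ t →
      HasDerivAt (fun t => -Y t) (-(fun y => -deriv U (-y)) (-Y t)) t := fun t ht => by
    simpa using (hYd t ht).fun_neg
  have hY0neg : -Y 0 ≤ b := by linarith [hY0.1]
  refine ⟨fun t ht => ⟨?_, ?_⟩, fun t hT => ?_⟩
  · have := le_of_hasDerivAt_neg_of_pos (g := fun y => -deriv U (-y))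
      (Y := fun t => -Y t) (hneg b ⟨hδb.le, le_rfl⟩) le_rfl ht hY0neg hYneg
    linarith
  · exact le_of_hasDerivAt_neg_of_pos (hpos a ⟨hδa.le, le_rfl⟩) le_rfl ht hY0.2 hYd
  · obtain ⟨hT₁, hT₂⟩ := max_le_iff.1 hT
    rw [MeasureTheory.integral_Icc_eq_integral_Ioc,
      ← intervalIntegral.integral_of_le hδa.le] at hT₁
    rw [MeasureTheory.integral_Icc_eq_integral_Ioc,
      ← intervalIntegral.integral_of_le (by linarith),
      ← intervalIntegral.integral_comp_neg (fun y => 1 / (-deriv U y))] at hT₂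
    have ht : 0 ≤ t := (intervalIntegral.integral_nonneg hδa.le
      fun y hy => (one_div_pos.2 (hpos y hy)).le).trans hT₁
    have hupper := le_of_integral_one_div_le hg hδa hpos hY0.2 hYd ht hT₁
    have hlower := le_of_integral_one_div_le (g := fun y => -deriv U (-y))
      (Y := fun t => -Y t) (hg.comp continuous_neg).neg hδb hneg hY0neg hYneg ht hT₂
    exact abs_le.2 ⟨by linarith, hupper⟩
end

section
/- Let a, b > 0, γ > 0 and let U : ℝ → ℝ be continuously differentiable with U'(y)·y > 0 for all y ∈ [-b,a] \ {0}. Then there exist μ₂ > 0 and ε₀ ∈ (0,1) with 2ε₀^γ < min(a,b) such that for all 0 < ε ≤ ε₀, every differentiable Y : [0,∞) → ℝ with Y(0) ∈ [-b,a] and Y'(t) = -U'(Y(t)) for all t satisfies Y(t) ∈ [-b + 2ε^γ, a - 2ε^γ] for all t ≥ μ₂·ε^γ. -/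
open Set

/-- A solution of `Ẏ = -f(Y)` starting below `a`, where `f > k > 0` on `[a - δ, a]`, lies below
`a - δ` from time `δ / k` on. -/
theorem le_sub_of_lt_drift {f Y : ℝ → ℝ} {a δ k : ℝ} (hk : 0 < k) (hδ : 0 ≤ δ)
    (hf : ∀ y ∈ Icc (a - δ) a, k < f y) (h0 : Y 0 ≤ a)
    (hY : ∀ t : ℝ, 0 ≤ t → HasDerivAt Y (-f (Y t)) t) {t : ℝ} (ht : δ / k ≤ t) :
    Y t ≤ a - δ := by
  have hT : 0 ≤ δ / k := by positivity
  have hline : Y (δ / k) ≤ a - k * (δ / k) := by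
    refine image_le_of_deriv_right_lt_deriv_boundary (f := Y) (f' := fun s => -f (Y s))
      (B := fun s => a - k * s) (B' := fun _ => -k) (a := 0) (b := δ / k)
      (fun s hs => (hY s hs.1).continuousAt.continuousWithinAt)
      (fun s hs => (hY s hs.1).hasDerivWithinAt) (by simpa using h0)
      (fun s => by simpa using ((hasDerivAt_id s).const_mul k).const_sub a) ?_
      (right_mem_Icc.2 hT)
    intro s hs hYs
    have hks : k * s ≤ δ := by
      have := (lt_div_iff₀ hk).1 hs.2
      linarith
    have hks0 : 0 ≤ k * s := mul_nonneg hk.le hs.1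
    exact neg_lt_neg (hf _ ⟨by linarith, by linarith⟩)
  rw [mul_div_cancel₀ _ hk.ne'] at hline
  refine image_le_of_deriv_right_lt_deriv_boundary (f := Y) (f' := fun s => -f (Y s))
    (B := fun _ => a - δ) (B' := fun _ => 0) (a := δ / k) (b := t)
    (fun s hs => (hY s (hT.trans hs.1)).continuousAt.continuousWithinAt)
    (fun s hs => (hY s (hT.trans hs.1)).hasDerivWithinAt) hline
    (fun s => hasDerivAt_const s _) ?_ (right_mem_Icc.2 ht)
  intro s _ hYs
  have := hf (Y s) ⟨hYs.ge, by linarith⟩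
  linarith

/-- A continuous function that is positive on a compact set has a positive strict lower bound
there. -/
theorem IsCompact.exists_pos_forall_lt {s : Set ℝ} (hs : IsCompact s) {f : ℝ → ℝ}
    (hf : ContinuousOn f s) (hpos : ∀ y ∈ s, 0 < f y) : ∃ k, 0 < k ∧ ∀ y ∈ s, k < f y := by
  obtain rfl | hne := s.eq_empty_or_nonempty
  · exact ⟨1, one_pos, by simp⟩
  · obtain ⟨x, hx, hmin⟩ := hs.exists_isMinOn hne hf
    exact ⟨f x / 2, half_pos (hpos x hx),
      fun y hy => (half_lt_self (hpos x hx)).trans_le (hmin hy)⟩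

/-- Retreat from the boundary in time of order `ε^γ`: under `U'(y)·y > 0` on
`[-b,a] \ {0}`, there are `μ₂ > 0` and `ε₀ ∈ (0,1)` with `2ε₀^γ < min a b` such that
for all `0 < ε ≤ ε₀`, every trajectory of `Ẏ = -U'(Y)` started in `[-b,a]` lies in
the shrunken interval `[-b + 2ε^γ, a - 2ε^γ]` for all times `t ≥ μ₂ ε^γ`. -/
theorem retreat_from_boundary (a b γ : ℝ) (ha : 0 < a) (hb : 0 < b) (hγ : 0 < γ)
    (U : ℝ → ℝ) (hU : ContDiff ℝ 1 U)
    (hsign : ∀ y ∈ Set.Icc (-b) a, y ≠ 0 → deriv U y * y > 0) :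
    ∃ μ₂ : ℝ, 0 < μ₂ ∧ ∃ ε₀ ∈ Set.Ioo (0 : ℝ) 1, 2 * ε₀ ^ γ < min a b ∧
      ∀ ε : ℝ, 0 < ε → ε ≤ ε₀ →
        ∀ Y : ℝ → ℝ, Y 0 ∈ Set.Icc (-b) a →
          (∀ t : ℝ, 0 ≤ t → HasDerivAt Y (-deriv U (Y t)) t) →
          ∀ t : ℝ, μ₂ * ε ^ γ ≤ t →
            Y t ∈ Set.Icc (-b + 2 * ε ^ γ) (a - 2 * ε ^ γ) := by
  have hcont : Continuous (deriv U) := hU.continuous_deriv le_rfl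
  obtain ⟨k₁, hk₁, h₁⟩ := (isCompact_Icc (a := a / 2) (b := a)).exists_pos_forall_lt
    hcont.continuousOn fun y hy => by
      have hy0 : 0 < y := by linarith [hy.1]
      exact pos_of_mul_pos_left (hsign y ⟨by linarith, hy.2⟩ hy0.ne') hy0.le
  obtain ⟨k₂, hk₂, h₂⟩ := (isCompact_Icc (a := b / 2) (b := b)).exists_pos_forall_lt
    (f := fun y => -deriv U (-y)) (by fun_prop) fun y hy => by
      have hy0 : 0 < y := by linarith [hy.1]
      have := hsign (-y) ⟨by linarith [hy.2], by linarith⟩ (by linarith)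
      exact pos_of_mul_pos_left (b := y) (by linarith) hy0.le
  have hk : 0 < min k₁ k₂ := lt_min hk₁ hk₂
  have hm : 0 < min a b := lt_min ha hb
  set ε₀ : ℝ := min (1 / 2) ((min a b / 4) ^ γ⁻¹) with hε₀
  have hε₀pos : 0 < ε₀ := lt_min (by norm_num) (by positivity)
  have hε₀le : ε₀ ^ γ ≤ min a b / 4 := by
    calc ε₀ ^ γ ≤ ((min a b / 4) ^ γ⁻¹) ^ γ :=
          Real.rpow_le_rpow hε₀pos.le (min_le_right _ _) hγ.le
      _ = min a b / 4 := Real.rpow_inv_rpow (by positivity) hγ.ne'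
  refine ⟨2 / min k₁ k₂, by positivity, ε₀,
    ⟨hε₀pos, (min_le_left _ _).trans_lt (by norm_num)⟩, by linarith, ?_⟩
  intro ε hε hεε₀ Y hY0 hY t ht
  have hδ : 0 ≤ 2 * ε ^ γ := by positivity
  have hεle : ε ^ γ ≤ min a b / 4 := (Real.rpow_le_rpow hε.le hεε₀ hγ.le).trans hε₀le
  have hma : min a b ≤ a := min_le_left a b
  have hmb : min a b ≤ b := min_le_right a b
  rw [div_mul_eq_mul_div] at ht
  have upper : Y t ≤ a - 2 * ε ^ γ :=
    le_sub_of_lt_drift hk hδ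
      (fun y hy => (min_le_left _ _).trans_lt (h₁ y ⟨by linarith [hy.1], hy.2⟩)) hY0.2 hY ht
  have lower : -Y t ≤ b - 2 * ε ^ γ :=
    le_sub_of_lt_drift (f := fun y => -deriv U (-y)) (Y := fun s => -Y s) hk hδ
      (fun y hy => (min_le_right _ _).trans_lt (h₂ y ⟨by linarith [hy.1], hy.2⟩))
      (by linarith [hY0.1]) (fun s hs => by simpa using (hY s hs).fun_neg) ht
  exact ⟨by linarith, upper⟩
end

section
/- Let U : ℝ → ℝ be twice continuously differentiable and let Y : [0,T] → ℝ be differentiable with Y'(t) = -U'(Y(t)) for all t ∈ [0,T]. Then for all 0 ≤ s ≤ t ≤ T, U'(Y(t)) = U'(Y(s))·e^{-∫_s^t U''(Y(u)) du}. Consequently, if in addition U''(Y(u)) ≥ 0 for all u ∈ [0,T] and U'(Y(0)) ≠ 0, then 0 ≤ ∫₀^t U''(Y(s))·(U'(Y(t))/U'(Y(s))) ds ≤ 1 for every t ∈ [0,T]. -/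
open Set in
/-- Variation of constants for the scalar homogeneous linear equation `g' = -a g`. -/
theorem eq_mul_exp_neg_integral_of_hasDerivAt {g a : ℝ → ℝ} {s t : ℝ} (hst : s ≤ t)
    (ha : ContinuousOn a (Icc s t))
    (hg : ∀ u ∈ Icc s t, HasDerivAt g (-(a u) * g u) u) :
    g t = g s * Real.exp (-∫ u in s..t, a u) := by
  let b : ℝ → ℝ := IccExtend hst ((Icc s t).domRestrict a)
  have hb : Continuous b := ha.domRestrict.Icc_extend'
  have hba : ∀ u ∈ Icc s t, b u = a u := fun u hu => by
    simp [b, IccExtend_of_mem hst _ hu]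
  have hint : ∫ u in s..t, a u = ∫ u in s..t, b u :=
    intervalIntegral.integral_congr fun u hu => (hba u (by rwa [uIcc_of_le hst] at hu)).symm
  have hF : ∀ u ∈ Icc s t,
      HasDerivAt (fun v => g v * Real.exp (∫ w in s..v, b w)) 0 u := fun u hu => by
    have hI : HasDerivAt (fun v => ∫ w in s..v, b w) (b u) u :=
      hb.integral_hasStrictDerivAt s u |>.hasDerivAt
    refine ((hg u hu).mul hI.exp).congr_deriv ?_
    rw [hba u hu]
    ring
  have hconst := constant_of_has_deriv_right_zero
    (fun u hu => (hF u hu).continuousAt.continuousWithinAt)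
    (fun u hu => (hF u (Ico_subset_Icc_self hu)).hasDerivWithinAt) t (right_mem_Icc.2 hst)
  simp only [intervalIntegral.integral_same, Real.exp_zero, mul_one] at hconst
  rw [hint, ← hconst, mul_assoc, ← Real.exp_add, add_neg_cancel, Real.exp_zero, mul_one]

open Set in
/-- If `g' = -a g` and `g` does not vanish on `[s, t]`, then `u ↦ g t / g u` is a primitive of
`u ↦ a u * (g t / g u)`. -/
theorem integral_mul_div_eq_one_sub {g a : ℝ → ℝ} {s t : ℝ} (hst : s ≤ t)
    (ha : ContinuousOn a (Icc s t))
    (hg : ∀ u ∈ Icc s t, HasDerivAt g (-(a u) * g u) u)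
    (hne : ∀ u ∈ Icc s t, g u ≠ 0) :
    ∫ u in s..t, a u * (g t / g u) = 1 - g t / g s := by
  rw [intervalIntegral.integral_eq_sub_of_hasDerivAt (f := fun u => g t / g u),
    div_self (hne t (right_mem_Icc.2 hst))]
  · intro u hu
    rw [uIcc_of_le hst] at hu
    have h := hne u hu
    refine ((hasDerivAt_const u (g t)).div (hg u hu) h).congr_deriv ?_
    field_simp
    ring
  · refine ContinuousOn.intervalIntegrable ?_
    rw [uIcc_of_le hst]
    exact ha.mul (continuousOn_const.div
      (fun u hu => (hg u hu).continuousAt.continuousWithinAt) hne)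


/-- Along a trajectory of `Ẏ = -U'(Y)`, `U'(Y t) = U'(Y s) e^{-∫ₛᵗ U''(Y u) du}`;
consequently, if `U'' ∘ Y ≥ 0` on `[0,T]` and `U'(Y 0) ≠ 0`, then
`0 ≤ ∫₀ᵗ U''(Y s)·(U'(Y t)/U'(Y s)) ds ≤ 1` for every `t ∈ [0,T]`. -/
theorem derivative_along_trajectory (U : ℝ → ℝ) (hU : ContDiff ℝ 2 U)
    (T : ℝ) (hT : 0 ≤ T) (Y : ℝ → ℝ)
    (hYd : ∀ t ∈ Set.Icc (0 : ℝ) T, HasDerivAt Y (-deriv U (Y t)) t) :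
    (∀ s ∈ Set.Icc (0 : ℝ) T, ∀ t ∈ Set.Icc (0 : ℝ) T, s ≤ t →
      deriv U (Y t) = deriv U (Y s) *
        Real.exp (-∫ u in s..t, deriv (deriv U) (Y u))) ∧
    ((∀ u ∈ Set.Icc (0 : ℝ) T, 0 ≤ deriv (deriv U) (Y u)) → deriv U (Y 0) ≠ 0 →
      ∀ t ∈ Set.Icc (0 : ℝ) T,
        0 ≤ (∫ s in (0 : ℝ)..t, deriv (deriv U) (Y s) * (deriv U (Y t) / deriv U (Y s))) ∧
        (∫ s in (0 : ℝ)..t, deriv (deriv U) (Y s) * (deriv U (Y t) / deriv U (Y s))) ≤ 1) := by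
  have hU' : ContDiff ℝ 1 (deriv U) := hU.deriv' (n := 1)
  have hU'' : Continuous (deriv (deriv U)) := hU'.continuous_deriv le_rfl
  have hg : ∀ u ∈ Set.Icc (0 : ℝ) T, HasDerivAt (fun v => deriv U (Y v))
      (-(deriv (deriv U) (Y u)) * deriv U (Y u)) u := fun u hu =>
    (((hU'.differentiable one_ne_zero (Y u)).hasDerivAt.comp u (hYd u hu)).congr_deriv
      (by ring))
  have ha : ContinuousOn (fun u => deriv (deriv U) (Y u)) (Set.Icc 0 T) :=
    hU''.comp_continuousOn fun u hu => (hYd u hu).continuousAt.continuousWithinAt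
  have hexp : ∀ s ∈ Set.Icc (0 : ℝ) T, ∀ t ∈ Set.Icc (0 : ℝ) T, s ≤ t →
      deriv U (Y t) = deriv U (Y s) *
        Real.exp (-∫ u in s..t, deriv (deriv U) (Y u)) := fun s hs t ht hst =>
    have hsub := Set.Icc_subset_Icc hs.1 ht.2
    eq_mul_exp_neg_integral_of_hasDerivAt hst (ha.mono hsub) fun u hu => hg u (hsub hu)
  refine ⟨hexp, fun hpos h0 t ht => ?_⟩
  have hmem0 : (0 : ℝ) ∈ Set.Icc 0 T := Set.left_mem_Icc.2 hT
  have hsub : Set.Icc 0 t ⊆ Set.Icc 0 T := Set.Icc_subset_Icc_right ht.2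
  have hne : ∀ u ∈ Set.Icc (0 : ℝ) t, deriv U (Y u) ≠ 0 := fun u hu => by
    rw [hexp 0 hmem0 u (hsub hu) hu.1]
    exact mul_ne_zero h0 (Real.exp_ne_zero _)
  have hI : 0 ≤ ∫ u in (0 : ℝ)..t, deriv (deriv U) (Y u) :=
    intervalIntegral.integral_nonneg ht.1 fun u hu => hpos u (hsub hu)
  rw [integral_mul_div_eq_one_sub (g := fun v => deriv U (Y v)) ht.1 (ha.mono hsub)
    (fun u hu => hg u (hsub hu)) hne, hexp 0 hmem0 t ht ht.1, mul_div_cancel_left₀ _ h0]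
  exact ⟨sub_nonneg.2 (Real.exp_le_one_iff.2 (neg_nonpos.2 hI)),
    sub_le_self _ (Real.exp_pos _).le⟩
end

section
/- Let U : ℝ → ℝ be twice continuously differentiable, let T > 0, and let Y : [0,T] → ℝ be differentiable with Y'(t) = -U'(Y(t)) for all t, such that U''(Y(s)) ≥ 0 for all s ∈ [0,T]. Assume that for every v in the range of Y and every z ∈ [-2,2] one has -U'(v+z+8) + U'(v) + U''(v)·z < 0 and -U'(v+z-8) + U'(v) + U''(v)·z > 0. Then for every bounded measurable ζ : [0,T] → ℝ with ζ(0) = 0 and sup_{t∈[0,T]} |ζ(t)| < 1, every bounded measurable x̃ : [0,T] → ℝ satisfying x̃(t) = Y(0) - ∫₀^t U'(x̃(s)) ds + ζ(t) for all t ∈ [0,T] satisfies sup_{t∈[0,T]} |x̃(t) - Y(t)| < 10. -/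
open MeasureTheory Set Filter Topology intervalIntegral

theorem intervalIntegrable_of_measurable_of_bounded {g : ℝ → ℝ} {T C : ℝ} (hT : 0 ≤ T)
    (hg : Measurable g) (hC : ∀ t ∈ Icc (0 : ℝ) T, |g t| ≤ C) :
    IntervalIntegrable g volume 0 T := by
  rw [intervalIntegrable_iff_integrableOn_Icc_of_le hT]
  refine Measure.integrableOn_of_bounded (M := C) ?_ hg.aestronglyMeasurable ?_
  · simp
  · filter_upwards [ae_restrict_mem measurableSet_Icc] with t ht using hC t ht

theorem IntervalIntegrable.mono_Icc {g : ℝ → ℝ} {T s t : ℝ}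
    (hg : IntervalIntegrable g volume 0 T) (hs : s ∈ Icc (0 : ℝ) T) (ht : t ∈ Icc (0 : ℝ) T) :
    IntervalIntegrable g volume s t := by
  refine hg.mono_set ?_
  rw [uIcc_of_le (hs.1.trans hs.2)]
  exact uIcc_subset_Icc hs ht

/-- The solution of `P' = -a (P + ζ)`, `P 0 = 0`, with `a ≥ 0` is bounded by `sup |ζ|`. -/
theorem exists_linear_response {a ζ : ℝ → ℝ} {T M : ℝ} (hT : 0 ≤ T) (ha : Continuous a)
    (ha₀ : ∀ t, 0 ≤ a t) (hζ : IntervalIntegrable ζ volume 0 T)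
    (hM : ∀ t ∈ Icc (0 : ℝ) T, |ζ t| ≤ M) :
    ∃ P : ℝ → ℝ, ContinuousOn P (Icc 0 T) ∧ ∀ t ∈ Icc (0 : ℝ) T,
      |P t| ≤ M ∧ P t = -∫ s in (0 : ℝ)..t, a s * (P s + ζ s) := by
  set A : ℝ → ℝ := fun t ↦ ∫ s in (0 : ℝ)..t, a s with hA
  have hAd : ∀ t, HasDerivAt A (a t) t := fun t ↦ (ha.integral_hasStrictDerivAt 0 t).hasDerivAt
  have hAc : Continuous A := continuous_iff_continuousAt.2 fun t ↦ (hAd t).continuousAt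
  have hA0 : A 0 = 0 := by simp [hA]
  have hAnn : ∀ t, 0 ≤ t → 0 ≤ A t := fun t ht ↦ integral_nonneg ht fun s _ ↦ ha₀ s
  have hM0 : 0 ≤ M := (abs_nonneg _).trans (hM 0 (left_mem_Icc.2 hT))
  set g : ℝ → ℝ := fun s ↦ Real.exp (A s) * a s * ζ s with hg
  have hgi : IntervalIntegrable g volume 0 T :=
    hζ.continuousOn_mul ((Real.continuous_exp.comp hAc).mul ha).continuousOn
  set G : ℝ → ℝ := fun t ↦ ∫ s in (0 : ℝ)..t, g s with hG
  have hGc : ContinuousOn G (Icc 0 T) := by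
    have := continuousOn_primitive_interval' hgi left_mem_uIcc
    rwa [uIcc_of_le hT] at this
  set F : ℝ → ℝ := fun t ↦ Real.exp (-A t) with hF
  have hFd : ∀ t, HasDerivAt F (-a t * F t) t := fun t ↦ by
    simpa [hF, mul_comm] using (hAd t).neg.exp
  have hFc : Continuous F := continuous_iff_continuousAt.2 fun t ↦ (hFd t).continuousAt
  have hFC : ContDiff ℝ 1 F := by
    rw [contDiff_one_iff_deriv]
    refine ⟨fun t ↦ (hFd t).differentiableAt, ?_⟩
    rw [funext fun t ↦ (hFd t).deriv]
    exact ha.neg.mul hFc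
  refine ⟨fun t ↦ -(F t * G t), (hFc.continuousOn.mul hGc).neg, fun t ht ↦ ⟨?_, ?_⟩⟩
  · have hbd : |G t| ≤ M * (Real.exp (A t) - 1) := by
      have hd : ∀ s, HasDerivAt (fun u ↦ M * Real.exp (A u)) (M * (Real.exp (A s) * a s)) s :=
        fun s ↦ (hAd s).exp.const_mul M
      have hc : Continuous fun s ↦ M * (Real.exp (A s) * a s) :=
        continuous_const.mul ((Real.continuous_exp.comp hAc).mul ha)
      have hftc := integral_eq_sub_of_hasDerivAt (a := 0) (b := t) (fun s _ ↦ hd s)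
        (hc.intervalIntegrable 0 t)
      calc |G t| ≤ ∫ s in (0 : ℝ)..t, M * (Real.exp (A s) * a s) := by
            rw [← Real.norm_eq_abs]
            refine norm_integral_le_of_norm_le ht.1 (.of_forall fun s hs ↦ ?_)
              (hc.intervalIntegrable 0 t)
            have hz := hM s ⟨hs.1.le, hs.2.trans ht.2⟩
            have hp : 0 ≤ Real.exp (A s) * a s := mul_nonneg (Real.exp_pos _).le (ha₀ s)
            rw [Real.norm_eq_abs, hg, abs_mul, abs_of_nonneg hp, mul_comm M]
            exact mul_le_mul_of_nonneg_left hz hp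
        _ = M * (Real.exp (A t) - 1) := by rw [hftc, hA0, Real.exp_zero]; ring
    have hFpos : 0 < F t := Real.exp_pos _
    have hFe : F t * Real.exp (A t) = 1 := by simp [hF, ← Real.exp_add]
    rw [abs_neg, abs_mul, abs_of_pos hFpos]
    calc F t * |G t| ≤ F t * (M * (Real.exp (A t) - 1)) := by gcongr
      _ = M * (F t * Real.exp (A t)) - M * F t := by ring
      _ ≤ M := by rw [hFe]; nlinarith
  · have hgt := hgi.mono_Icc (left_mem_Icc.2 hT) ht
    have hGac := hgt.absolutelyContinuousOnInterval_intervalIntegral (c := 0) left_mem_uIcc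
    have hFac : AbsolutelyContinuousOnInterval F 0 t :=
      hFC.contDiffOn.absolutelyContinuousOnInterval
    have h := hFac.integral_deriv_mul_eq_sub hGac
    simp only [integral_same, mul_zero, sub_zero] at h
    change -(F t * G t) = _
    rw [neg_inj]
    refine h.symm.trans (integral_congr_ae ?_)
    filter_upwards [hgt.ae_hasDerivAt_integral] with s hs hst
    have hs' := (hs (uIoc_subset_uIcc hst) 0 left_mem_uIcc).deriv
    rw [hs', (hFd s).deriv]
    have hFe : F s * Real.exp (A s) = 1 := by simp [hF, ← Real.exp_add]
    change -a s * F s * G s + F s * (Real.exp (A s) * a s * ζ s) = a s * (-(F s * G s) + ζ s)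
    linear_combination a s * ζ s * hFe

/-- A primitive starting at `0` stays below the level `c` if its density is nonpositive
whenever the primitive is just below or at that level. -/
theorem integral_lt_of_barrier {f R : ℝ → ℝ} {T c δ : ℝ} (hc : 0 < c) (hδ : 0 < δ)
    (hf : IntervalIntegrable f volume 0 T)
    (hR : ∀ t ∈ Icc (0 : ℝ) T, R t = ∫ s in (0 : ℝ)..t, f s)
    (hbar : ∀ t ∈ Icc (0 : ℝ) T, c - δ < R t → R t ≤ c → f t ≤ 0) :
    ∀ t ∈ Icc (0 : ℝ) T, R t < c := by
  intro t ht
  by_contra! hcon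
  have hT : 0 ≤ T := ht.1.trans ht.2
  have hRc : ContinuousOn R (Icc 0 T) := by
    have h := continuousOn_primitive_interval' hf left_mem_uIcc
    rw [uIcc_of_le hT] at h
    exact h.congr hR
  set S : Set ℝ := Icc 0 T ∩ R ⁻¹' Ici c
  have hS : IsCompact S :=
    isCompact_Icc.of_isClosed_subset (hRc.preimage_isClosed_of_isClosed isClosed_Icc isClosed_Ici)
      inter_subset_left
  obtain ⟨τ, ⟨hτT, hτc⟩, hτmin⟩ := hS.exists_isLeast ⟨t, ht, hcon⟩
  have hbelow : ∀ s ∈ Icc (0 : ℝ) T, s < τ → R s < c := fun s hs hst ↦ by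
    by_contra! h
    exact hst.not_ge (hτmin ⟨hs, h⟩)
  have hR0 : R 0 = 0 := by simpa using hR 0 (left_mem_Icc.2 hT)
  have hτ0 : 0 < τ := hτT.1.lt_of_ne fun h ↦ by
    rw [mem_preimage, ← h, hR0] at hτc
    exact hτc.not_gt hc
  have hev : ∀ᶠ s in 𝓝[Icc 0 T] τ, c - δ < R s :=
    (hRc τ hτT).eventually (lt_mem_nhds (by have : c ≤ R τ := hτc; linarith))
  obtain ⟨η, hη, hball⟩ := Metric.mem_nhdsWithin_iff.1 hev
  set s := max 0 (τ - η / 2)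
  have hs0 : 0 ≤ s := le_max_left _ _
  have hsη : τ - η / 2 ≤ s := le_max_right _ _
  have hsτ : s < τ := max_lt hτ0 (by linarith)
  have hsT : s ∈ Icc (0 : ℝ) T := ⟨hs0, hsτ.le.trans hτT.2⟩
  have hinc : R τ - R s = ∫ u in s..τ, f u := by
    rw [hR τ hτT, hR s hsT]
    exact integral_interval_sub_left (hf.mono_Icc (left_mem_Icc.2 hT) hτT)
      (hf.mono_Icc (left_mem_Icc.2 hT) hsT)
  have hneg : ∫ u in s..τ, f u ≤ 0 := by
    have h : ∫ u in s..τ, f u ≤ ∫ _ in s..τ, (0 : ℝ) := by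
      refine integral_mono_on_of_le_Ioo hsτ.le (hf.mono_Icc hsT hτT)
        intervalIntegrable_const fun u hu ↦ ?_
      have huT : u ∈ Icc (0 : ℝ) T := ⟨hs0.trans hu.1.le, hu.2.le.trans hτT.2⟩
      refine hbar u huT (hball ⟨?_, huT⟩) (hbelow u huT hu.2).le
      rw [Metric.mem_ball, Real.dist_eq, abs_lt]
      constructor <;> linarith [hu.1, hu.2]
    simpa using h
  have hτc' : c ≤ R τ := hτc
  linarith [hbelow s hsT hsτ]

/-- A strict inequality over a compact parameter set persists for nearby levels. -/
theorem exists_uniform_barrier {Φ : ℝ → ℝ × ℝ → ℝ} (hΦ : Continuous (Function.uncurry Φ))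
    {K : Set (ℝ × ℝ)} (hK : IsCompact K) {c : ℝ} (h : ∀ p ∈ K, Φ c p < 0) :
    ∃ δ > 0, ∀ r, |r - c| < δ → ∀ p ∈ K, Φ r p < 0 := by
  have hev : ∀ᶠ r in 𝓝 c, ∀ p ∈ K, Φ r p < 0 :=
    hK.eventually_forall_of_forall_eventually fun p hp ↦
      hΦ.continuousAt.eventually (gt_mem_nhds (h p hp))
  exact Metric.eventually_nhds_iff.1 hev

/-- Lemma 9 of the paper (deterministic content, deviation during the return from
`-∞`): along a trajectory `Y` of `Ẏ = -U'(Y)` on whose range the potential is convex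
and the barrier inequalities with constant `8` hold for `z ∈ [-2,2]`, every perturbed
trajectory `x'` driven by a noise path `ζ` with `ζ 0 = 0` and `sup_{[0,T]} |ζ| < 1`
(expressed by a bound `M < 1`) deviates from `Y` by less than `10` in supremum norm
(expressed by a bound `M' < 10`). -/
theorem deviation_bound_return_from_infinity (U : ℝ → ℝ) (hU : ContDiff ℝ 2 U)
    (T : ℝ) (hT : 0 < T) (Y : ℝ → ℝ)
    (hYd : ∀ t ∈ Set.Icc (0 : ℝ) T, HasDerivAt Y (-deriv U (Y t)) t)
    (hconv : ∀ s ∈ Set.Icc (0 : ℝ) T, 0 ≤ deriv (deriv U) (Y s))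
    (hbar₁ : ∀ v ∈ Y '' Set.Icc (0 : ℝ) T, ∀ z ∈ Set.Icc (-2 : ℝ) 2,
      -deriv U (v + z + 8) + deriv U v + deriv (deriv U) v * z < 0)
    (hbar₂ : ∀ v ∈ Y '' Set.Icc (0 : ℝ) T, ∀ z ∈ Set.Icc (-2 : ℝ) 2,
      -deriv U (v + z - 8) + deriv U v + deriv (deriv U) v * z > 0) :
    ∀ ζ x' : ℝ → ℝ, Measurable ζ → Measurable x' → ζ 0 = 0 →
      (∃ M : ℝ, M < 1 ∧ ∀ t ∈ Set.Icc (0 : ℝ) T, |ζ t| ≤ M) →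
      (∃ Mx : ℝ, ∀ t ∈ Set.Icc (0 : ℝ) T, |x' t| ≤ Mx) →
      (∀ t ∈ Set.Icc (0 : ℝ) T,
        x' t = Y 0 - (∫ s in (0 : ℝ)..t, deriv U (x' s)) + ζ t) →
      ∃ M' : ℝ, M' < 10 ∧ ∀ t ∈ Set.Icc (0 : ℝ) T, |x' t - Y t| ≤ M' := by
  intro ζ x' hζm hxm hζ0 ⟨M, hM1, hM⟩ ⟨Mx, hMx⟩ hx
  have hT0 : (0 : ℝ) ≤ T := hT.le
  have h0T : (0 : ℝ) ∈ Icc (0 : ℝ) T := left_mem_Icc.2 hT0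
  have hU1 : ContDiff ℝ 1 (deriv U) := (contDiff_succ_iff_deriv (n := 1)).1 hU |>.2.2
  have hUc : Continuous (deriv U) := hU1.continuous
  have hUUc : Continuous (deriv (deriv U)) := hU1.continuous_deriv le_rfl
  have hYc : ContinuousOn Y (Icc 0 T) := fun t ht ↦ (hYd t ht).continuousAt.continuousWithinAt
  set a : ℝ → ℝ := IccExtend hT0 ((Icc 0 T).domRestrict fun t ↦ deriv (deriv U) (Y t)) with ha_def
  have ha : Continuous a :=
    (continuousOn_iff_continuous_domRestrict.1 (hUUc.comp_continuousOn hYc)).Icc_extend'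
  have haY : ∀ t ∈ Icc (0 : ℝ) T, a t = deriv (deriv U) (Y t) := fun t ht ↦ by
    rw [ha_def, IccExtend_of_mem hT0 _ ht, domRestrict_apply]
  have ha₀ : ∀ t, 0 ≤ a t := fun t ↦ hconv _ (projIcc 0 T hT0 t).2
  have hζi : IntervalIntegrable ζ volume 0 T :=
    intervalIntegrable_of_measurable_of_bounded hT0 hζm hM
  obtain ⟨P, hPc, hP⟩ := exists_linear_response hT0 ha ha₀ hζi hM
  have hxi : IntervalIntegrable (fun s ↦ deriv U (x' s)) volume 0 T := by
    obtain ⟨C, hC⟩ := (isCompact_Icc (a := -Mx) (b := Mx)).exists_bound_of_continuousOn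
      hUc.continuousOn
    exact intervalIntegrable_of_measurable_of_bounded hT0 (hUc.measurable.comp hxm)
      fun t ht ↦ hC _ (abs_le.1 (hMx t ht))
  have hYi : IntervalIntegrable (fun s ↦ deriv U (Y s)) volume 0 T :=
    ContinuousOn.intervalIntegrable_of_Icc hT0 (hUc.comp_continuousOn hYc)
  have hPi : IntervalIntegrable (fun s ↦ a s * (P s + ζ s)) volume 0 T :=
    ((ContinuousOn.intervalIntegrable_of_Icc hT0 hPc).add hζi).continuousOn_mul ha.continuousOn
  have hYint : ∀ t ∈ Icc (0 : ℝ) T, ∫ s in (0 : ℝ)..t, deriv U (Y s) = Y 0 - Y t := fun t ht ↦ by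
    have h := integral_eq_sub_of_hasDerivAt (a := 0) (b := t) (f := Y)
      (fun s hs ↦ hYd s (uIcc_subset_Icc h0T ht hs)) (hYi.mono_Icc h0T ht).neg
    rw [intervalIntegral.integral_neg] at h
    linarith
  set f : ℝ → ℝ := fun s ↦ -deriv U (x' s) + deriv U (Y s) + a s * (P s + ζ s) with hf_def
  set R : ℝ → ℝ := fun t ↦ x' t - Y t - (P t + ζ t) with hR_def
  have hfi : IntervalIntegrable f volume 0 T := (hxi.neg.add hYi).add hPi
  have hR : ∀ t ∈ Icc (0 : ℝ) T, R t = ∫ s in (0 : ℝ)..t, f s := fun t ht ↦ by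
    have h1 := hxi.mono_Icc h0T ht
    have h2 := hYi.mono_Icc h0T ht
    have h3 := hPi.mono_Icc h0T ht
    have hsum : ∫ s in (0 : ℝ)..t, f s = -(∫ s in (0 : ℝ)..t, deriv U (x' s))
        + (∫ s in (0 : ℝ)..t, deriv U (Y s)) + ∫ s in (0 : ℝ)..t, a s * (P s + ζ s) := by
      rw [← intervalIntegral.integral_neg]
      exact (integral_add (h1.neg.add h2) h3).trans
        (congrArg (· + _) (integral_add h1.neg h2))
    rw [hsum, hYint t ht]
    simp only [hR_def]
    linarith [hx t ht, (hP t ht).2]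
  have hZ : ∀ t ∈ Icc (0 : ℝ) T, |P t + ζ t| ≤ 2 * M := fun t ht ↦ by
    linarith [abs_add_le (P t) (ζ t), (hP t ht).1, hM t ht]
  have hK : IsCompact ((Y '' Icc (0 : ℝ) T) ×ˢ Icc (-2 : ℝ) 2) :=
    (isCompact_Icc.image_of_continuousOn hYc).prod isCompact_Icc
  have hKmem : ∀ t ∈ Icc (0 : ℝ) T,
      (Y t, P t + ζ t) ∈ (Y '' Icc (0 : ℝ) T) ×ˢ Icc (-2 : ℝ) 2 := fun t ht ↦
    ⟨mem_image_of_mem Y ht, abs_le.1 ((hZ t ht).trans (by linarith))⟩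
  have hfR : ∀ t ∈ Icc (0 : ℝ) T, f t = -deriv U (Y t + (P t + ζ t) + R t) + deriv U (Y t)
      + deriv (deriv U) (Y t) * (P t + ζ t) := fun t ht ↦ by
    simp only [hf_def, hR_def, haY t ht]
    ring_nf
  obtain ⟨δ₁, hδ₁, hΦ₁⟩ := exists_uniform_barrier (c := 8)
    (Φ := fun r p ↦ -deriv U (p.1 + p.2 + r) + deriv U p.1 + deriv (deriv U) p.1 * p.2)
    (by unfold Function.uncurry; fun_prop) hK fun p hp ↦ hbar₁ p.1 hp.1 p.2 hp.2
  obtain ⟨δ₂, hδ₂, hΦ₂⟩ := exists_uniform_barrier (c := 8)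
    (Φ := fun r p ↦ -(-deriv U (p.1 + p.2 - r) + deriv U p.1 + deriv (deriv U) p.1 * p.2))
    (by unfold Function.uncurry; fun_prop) hK fun p hp ↦ neg_lt_zero.2 (hbar₂ p.1 hp.1 p.2 hp.2)
  have hupper : ∀ t ∈ Icc (0 : ℝ) T, R t < 8 := by
    refine integral_lt_of_barrier (by norm_num) hδ₁ hfi hR fun t ht h1 h2 ↦ ?_
    rw [hfR t ht]
    exact (hΦ₁ (R t) (abs_lt.2 ⟨by linarith, by linarith⟩) _ (hKmem t ht)).le
  have hlower : ∀ t ∈ Icc (0 : ℝ) T, -R t < 8 := by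
    refine integral_lt_of_barrier (f := fun s ↦ -f s) (R := fun s ↦ -R s) (by norm_num) hδ₂
      hfi.neg (fun t ht ↦ by rw [intervalIntegral.integral_neg, hR t ht]) fun t ht h1 h2 ↦ ?_
    have h := (hΦ₂ (-R t) (abs_lt.2 ⟨by linarith, by linarith⟩) _ (hKmem t ht)).le
    rw [hfR t ht]
    simpa only [sub_neg_eq_add] using h
  refine ⟨2 * M + 8, by linarith, fun t ht ↦ ?_⟩
  have hz := abs_le.1 (hZ t ht)
  have h1 := hupper t ht
  have h2 := hlower t ht
  simp only [hR_def] at h1 h2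
  exact abs_le.2 ⟨by linarith [hz.1], by linarith [hz.2]⟩
end
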